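/- arXiv:1908.08273 — 5 statements merged into one kernel-verified Lean document; each statement's English description precedes it below -/
import Mathlib

section
/- Every finite simple cubic (3-regular) graph G with n vertices admits a contact representation by triangles lying on an integer grid of size 3n/2 × 3n/2 × n/2: there is an injective assignment e ↦ p_e of points of ℤ³ to the edges of G, with first and second coordinates among 3n/2 fixed consecutive integers and third coordinates among n/2 fixed consecutive integers, such that for every vertex v the three points {p_e : e incident to v} are affinely independent and, writing T_v for their convex hull, for distinct vertices u, v one has T_u ∩ T_v = {p_{uv}} if uv is an edge of G and T_u ∩ T_v = ∅ otherwise. -/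
/-- The linear functional on `ℝ³` with the given coefficients. -/
noncomputable def linearForm (α β γ : ℝ) : EuclideanSpace ℝ (Fin 3) →ₗ[ℝ] ℝ where
  toFun v := α * v 0 + β * v 1 + γ * v 2
  map_add' v w := by simp only [PiLp.add_apply]; ring
  map_smul' r v := by simp only [PiLp.smul_apply, smul_eq_mul, RingHom.id_apply]; ring

/-- The point of `ℝ³` with the given integer coordinates. -/
noncomputable def gridPoint (x y z : ℤ) : EuclideanSpace ℝ (Fin 3) := !₂[(x : ℝ), (y : ℝ), (z : ℝ)]

theorem linearForm_gridPoint (α β γ : ℝ) (x y z : ℤ) :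
    linearForm α β γ (gridPoint x y z) = α * x + β * y + γ * z := by
  simp [linearForm, gridPoint]

theorem gridPoint_inj {x y z x' y' z' : ℤ} :
    gridPoint x y z = gridPoint x' y' z' ↔ x = x' ∧ y = y' ∧ z = z' := by
  constructor
  · intro h
    have h0 := congrArg (· 0) h
    have h1 := congrArg (· 1) h
    have h2 := congrArg (· 2) h
    simp [gridPoint] at h0 h1 h2
    exact ⟨h0, h1, h2⟩
  · rintro ⟨rfl, rfl, rfl⟩; rfl

theorem mem_convexHull_face {E : Type*} [AddCommGroup E] [Module ℝ E] {S : Set E}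
    (φ : E →ₗ[ℝ] ℝ) (c : ℝ) (hS : ∀ s ∈ S, φ s ≤ c) {x : E} (hx : x ∈ convexHull ℝ S)
    (hc : c ≤ φ x) : x ∈ convexHull ℝ {s ∈ S | φ s = c} := by
  rw [convexHull_eq] at hx
  obtain ⟨ι, t, w, z, hw0, hw1, hz, rfl⟩ := hx
  rw [Finset.centerMass_eq_of_sum_1 _ _ hw1] at hc ⊢
  rw [map_sum] at hc
  simp only [map_smul, smul_eq_mul] at hc
  have hle : ∀ i ∈ t, w i * φ (z i) ≤ w i * c := fun i hi =>
    mul_le_mul_of_nonneg_left (hS _ (hz i hi)) (hw0 i hi)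
  have hsum : ∑ i ∈ t, w i * φ (z i) = ∑ i ∈ t, w i * c := by
    refine le_antisymm (Finset.sum_le_sum hle) ?_
    rw [← Finset.sum_mul, hw1, one_mul]
    exact hc
  have heq := (Finset.sum_eq_sum_iff_of_le hle).1 hsum
  have hzero : ∀ i ∈ t, w i ≠ 0 → φ (z i) = c := fun i hi hwi =>
    mul_left_cancel₀ hwi (heq i hi)
  have : ∑ i ∈ t, w i • z i = ∑ i ∈ t with w i ≠ 0, w i • z i := by
    rw [Finset.sum_filter_of_ne]
    intro i _ hi h0
    exact hi (by rw [h0, zero_smul])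
  rw [this]
  refine (convex_convexHull ℝ _).sum_mem (fun i hi => hw0 i (Finset.mem_filter.1 hi).1) ?_ ?_
  · rw [Finset.sum_filter_ne_zero, hw1]
  · intro i hi
    obtain ⟨hi, hwi⟩ := Finset.mem_filter.1 hi
    exact subset_convexHull ℝ _ ⟨hz i hi, hzero i hi hwi⟩

theorem mem_convexHull_faces {E : Type*} [AddCommGroup E] [Module ℝ E] {S T : Set E}
    (φ : E →ₗ[ℝ] ℝ) (c : ℝ) (hS : ∀ s ∈ S, φ s ≤ c) (hT : ∀ t ∈ T, c ≤ φ t) {x : E}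
    (hxS : x ∈ convexHull ℝ S) (hxT : x ∈ convexHull ℝ T) :
    x ∈ convexHull ℝ {s ∈ S | φ s = c} ∧ x ∈ convexHull ℝ {t ∈ T | φ t = c} := by
  have h1 : φ x ≤ c := convexHull_min (t := {y | φ y ≤ c}) hS
    (convex_halfSpace_le φ.isLinear c) hxS
  have h2 : c ≤ φ x := convexHull_min (t := {y | c ≤ φ y}) hT
    (convex_halfSpace_ge φ.isLinear c) hxT
  refine ⟨mem_convexHull_face φ c hS hxS h2, ?_⟩
  have := mem_convexHull_face (-φ) (-c) (fun s hs => by simpa using hT s hs) hxT (by simpa using h1)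
  simpa using this

theorem mem_convexHull_image_faces {ι κ E : Type*} [AddCommGroup E] [Module ℝ E] {I : Set ι}
    {J : Set κ} {f : ι → E} {g : κ → E} (φ : E →ₗ[ℝ] ℝ) (c : ℝ) (hI : ∀ i ∈ I, φ (f i) ≤ c)
    (hJ : ∀ j ∈ J, c ≤ φ (g j)) {x : E} (hxI : x ∈ convexHull ℝ (f '' I))
    (hxJ : x ∈ convexHull ℝ (g '' J)) :
    x ∈ convexHull ℝ (f '' {i ∈ I | φ (f i) = c}) ∧
      x ∈ convexHull ℝ (g '' {j ∈ J | φ (g j) = c}) := by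
  obtain ⟨h1, h2⟩ := mem_convexHull_faces φ c (by rintro _ ⟨i, hi, rfl⟩; exact hI i hi)
    (by rintro _ ⟨j, hj, rfl⟩; exact hJ j hj) hxI hxJ
  refine ⟨convexHull_mono ?_ h1, convexHull_mono ?_ h2⟩
  · rintro _ ⟨⟨i, hi, rfl⟩, h⟩; exact ⟨i, ⟨hi, h⟩, rfl⟩
  · rintro _ ⟨⟨j, hj, rfl⟩, h⟩; exact ⟨j, ⟨hj, h⟩, rfl⟩

theorem eq_of_mem_convexHull_image {ι E : Type*} [AddCommGroup E] [Module ℝ E] {I : Set ι}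
    {f : ι → E} {p x : E} {q : Prop} (hI : ∀ i ∈ I, q ∧ f i = p)
    (hx : x ∈ convexHull ℝ (f '' I)) : q ∧ x = p := by
  obtain ⟨_, i, hi, rfl⟩ := convexHull_nonempty_iff.1 ⟨x, hx⟩
  refine ⟨(hI i hi).1, ?_⟩
  have := convexHull_mono (t := {p}) (by rintro _ ⟨i, hi, rfl⟩; exact (hI i hi).2) hx
  simpa using this

theorem affineIndependent_three_iff {E : Type*} [AddCommGroup E] [Module ℝ E] (P Q R : E) :
    AffineIndependent ℝ ![P, Q, R] ↔
      ∀ a b c : ℝ, a + b + c = 0 → a • P + b • Q + c • R = 0 → a = 0 ∧ b = 0 ∧ c = 0 := by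
  rw [affineIndependent_iff_of_fintype]
  constructor
  · intro h a b c h0 h1
    have := h ![a, b, c] (by simpa [Fin.sum_univ_three] using h0) (by
      rw [Finset.weightedVSub_eq_linear_combination]
      · simpa [Fin.sum_univ_three] using h1
      · simpa [Fin.sum_univ_three] using h0)
    exact ⟨this 0, this 1, this 2⟩
  · intro h w h0 h1 i
    rw [Finset.weightedVSub_eq_linear_combination _ h0] at h1
    simp only [Fin.sum_univ_three] at h0 h1
    have := h _ _ _ h0 (by simpa using h1)
    fin_cases i
    exacts [this.1, this.2.1, this.2.2]

theorem affineIndependent_three_of_linearForm {E : Type*} [AddCommGroup E] [Module ℝ E]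
    {P Q R : E} (φ χ : E →ₗ[ℝ] ℝ) (h1 : φ P = φ Q) (h2 : φ R ≠ φ P) (h3 : χ P ≠ χ Q) :
    AffineIndependent ℝ ![P, Q, R] := by
  rw [affineIndependent_three_iff]
  intro a b c h0 h
  have hφ := congrArg φ h
  have hχ := congrArg χ h
  simp only [map_add, map_smul, smul_eq_mul, map_zero] at hφ hχ
  have hc : c = 0 := by
    have : c * (φ R - φ P) = 0 := by rw [← h1] at hφ; linear_combination hφ - φ P * h0
    exact (mul_eq_zero.1 this).resolve_right (sub_ne_zero.2 h2)
  subst hc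
  have hb : a = 0 := by
    have : a * (χ P - χ Q) = 0 := by linear_combination hχ - χ Q * h0
    exact (mul_eq_zero.1 this).resolve_right (sub_ne_zero.2 h3)
  subst hb
  exact ⟨rfl, by linarith, rfl⟩

/-- Three points, each of which is strictly separated from the other two by a functional
supporting the triangle, are affinely independent. -/
theorem affineIndependent_three_of_exposed {E : Type*} [AddCommGroup E] [Module ℝ E]
    {P Q R : E} (φ₁ φ₂ φ₃ : E →ₗ[ℝ] ℝ) (h12 : φ₁ P < φ₁ Q) (h13 : φ₁ P < φ₁ R)
    (h21 : φ₂ Q < φ₂ P) (h23 : φ₂ Q < φ₂ R) (h31 : φ₃ R < φ₃ P) (h32 : φ₃ R < φ₃ Q) :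
    AffineIndependent ℝ ![P, Q, R] := by
  rw [affineIndependent_three_iff]
  intro a b c h0 h
  have e1 := congrArg φ₁ h
  have e2 := congrArg φ₂ h
  have e3 := congrArg φ₃ h
  simp only [map_add, map_smul, smul_eq_mul, map_zero] at e1 e2 e3
  have k1 : b * (φ₁ Q - φ₁ P) + c * (φ₁ R - φ₁ P) = 0 := by
    linear_combination e1 - φ₁ P * h0
  have k2 : a * (φ₂ P - φ₂ Q) + c * (φ₂ R - φ₂ Q) = 0 := by
    linear_combination e2 - φ₂ Q * h0
  have k3 : a * (φ₃ P - φ₃ R) + b * (φ₃ Q - φ₃ R) = 0 := by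
    linear_combination e3 - φ₃ R * h0
  have opposite : ∀ {x y u v : ℝ}, 0 < u → 0 < v → x * u + y * v = 0 → x * y ≤ 0 := by
    intro x y u v hu hv hxy
    have : x * y * v = -(x ^ 2 * u) := by linear_combination x * hxy
    by_contra! hpos
    nlinarith [mul_pos hpos hv, mul_nonneg (sq_nonneg x) hu.le]
  have o1 := opposite (sub_pos.2 h12) (sub_pos.2 h13) k1
  have o2 := opposite (sub_pos.2 h21) (sub_pos.2 h23) k2
  have o3 := opposite (sub_pos.2 h31) (sub_pos.2 h32) k3
  have hu1 := sub_pos.2 h12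
  have hu2 := sub_pos.2 h21
  have hu3 := sub_pos.2 h31
  have hv1 := sub_pos.2 h13
  have hv2 := sub_pos.2 h23
  have hprod : a * (b * c) = 0 := by
    have : (a * b) * (a * c) * (b * c) ≤ 0 :=
      mul_nonpos_of_nonneg_of_nonpos (mul_nonneg_of_nonpos_of_nonpos o3 o2) o1
    have hsq : (a * (b * c)) ^ 2 ≤ 0 := by linarith
    exact pow_eq_zero_iff two_ne_zero |>.1 (le_antisymm hsq (sq_nonneg _))
  rcases mul_eq_zero.1 hprod with rfl | hbc
  · have : c = 0 := by simpa [hv2.ne'] using k2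
    exact ⟨rfl, by linarith, this⟩
  · rcases mul_eq_zero.1 hbc with rfl | rfl
    · have : c = 0 := by simpa [hv1.ne'] using k1
      exact ⟨by linarith, rfl, this⟩
    · have : b = 0 := by simpa [hu1.ne'] using k1
      exact ⟨by linarith, this, rfl⟩

/-- The three neighbours of a vertex of a cubic graph index the three edges at that vertex. -/
theorem bijective_incidentEdge {V : Type*} {G : SimpleGraph V} (v : V) (w : Fin 3 → V)
    (hinj : Function.Injective w) (hadj : ∀ i, G.Adj v (w i))
    (hall : ∀ u, G.Adj v u → ∃ i, u = w i) :
    Function.Bijective (fun i : Fin 3 =>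
      (⟨⟨s(v, w i), hadj i⟩, Sym2.mem_mk_left v (w i)⟩ :
        {e : G.edgeSet // v ∈ (e : Sym2 V)})) := by
  constructor
  · intro i j hij
    have h1 := congrArg (fun e => (e.1.1 : Sym2 V)) hij
    exact hinj (Sym2.congr_right.1 h1)
  · rintro ⟨⟨e, he⟩, hve⟩
    obtain ⟨u, rfl⟩ := Sym2.mem_iff_exists.1 hve
    obtain ⟨i, rfl⟩ := hall u he
    exact ⟨i, rfl⟩

/-- To represent a cubic graph it suffices to place a point for each ordered pair of adjacent
vertices, symmetrically. -/
theorem exists_representation_of_points {V : Type*} (G : SimpleGraph V) (m k : ℕ)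
    (X Y Z : V → V → ℤ) (x0 y0 z0 : ℤ)
    (pt : V → V → EuclideanSpace ℝ (Fin 3))
    (hpt : ∀ u v, pt u v = gridPoint (X u v) (Y u v) (Z u v))
    (hsymm : ∀ u v, G.Adj u v → pt u v = pt v u)
    (hinj : ∀ u v u' v', G.Adj u v → G.Adj u' v' → pt u v = pt u' v' → s(u, v) = s(u', v'))
    (hX : ∀ u v, G.Adj u v → x0 ≤ X u v ∧ X u v < x0 + m)
    (hY : ∀ u v, G.Adj u v → y0 ≤ Y u v ∧ Y u v < y0 + m)
    (hZ : ∀ u v, G.Adj u v → z0 ≤ Z u v ∧ Z u v < z0 + k)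
    (haff : ∀ v, ∃ w : Fin 3 → V, Function.Injective w ∧ (∀ i, G.Adj v (w i)) ∧
      (∀ u, G.Adj v u → ∃ i, u = w i) ∧ AffineIndependent ℝ (fun i => pt v (w i)))
    (hsep : ∀ u v, u ≠ v → ∀ x, x ∈ convexHull ℝ (pt u '' {w | G.Adj u w}) →
      x ∈ convexHull ℝ (pt v '' {w | G.Adj v w}) → G.Adj u v ∧ x = pt u v) :
    ∃ (p : G.edgeSet → EuclideanSpace ℝ (Fin 3)) (x0 y0 z0 : ℤ),
      Function.Injective p ∧
      (∀ e : G.edgeSet, ∃ a b c : ℤ,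
        p e 0 = (a : ℝ) ∧ p e 1 = (b : ℝ) ∧ p e 2 = (c : ℝ) ∧
        x0 ≤ a ∧ a < x0 + m ∧ y0 ≤ b ∧ b < y0 + m ∧ z0 ≤ c ∧ c < z0 + k) ∧
      (∀ v : V, AffineIndependent ℝ
        (fun e : {e : G.edgeSet // v ∈ (e : Sym2 V)} => p e.1)) ∧
      (∀ u v (huv : G.Adj u v),
        convexHull ℝ {x | ∃ e : G.edgeSet, u ∈ (e : Sym2 V) ∧ x = p e} ∩
          convexHull ℝ {x | ∃ e : G.edgeSet, v ∈ (e : Sym2 V) ∧ x = p e} =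
          {p ⟨s(u, v), G.mem_edgeSet.mpr huv⟩}) ∧
      (∀ u v, u ≠ v → ¬ G.Adj u v →
        convexHull ℝ {x | ∃ e : G.edgeSet, u ∈ (e : Sym2 V) ∧ x = p e} ∩
          convexHull ℝ {x | ∃ e : G.edgeSet, v ∈ (e : Sym2 V) ∧ x = p e} = ∅) := by
  let p : G.edgeSet → EuclideanSpace ℝ (Fin 3) := fun e => pt e.1.out.1 e.1.out.2
  have hp : ∀ u v (h : G.Adj u v), p ⟨s(u, v), G.mem_edgeSet.mpr h⟩ = pt u v := by
    intro u v h
    have hout : s(s(u, v).out.1, s(u, v).out.2) = s(u, v) := Quot.out_eq s(u, v)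
    change pt s(u, v).out.1 s(u, v).out.2 = pt u v
    rcases Sym2.eq_iff.1 hout with ⟨h1, h2⟩ | ⟨h1, h2⟩
    · rw [h1, h2]
    · rw [h1, h2, hsymm u v h]
  have hedge : ∀ e : G.edgeSet, ∃ u v, ∃ h : G.Adj u v, e = ⟨s(u, v), G.mem_edgeSet.mpr h⟩ := by
    rintro ⟨e, he⟩
    induction e using Sym2.ind with
    | _ u v => exact ⟨u, v, he, rfl⟩
  have hset : ∀ u, {x | ∃ e : G.edgeSet, u ∈ (e : Sym2 V) ∧ x = p e} =
      pt u '' {w | G.Adj u w} := by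
    intro u
    ext x
    constructor
    · rintro ⟨⟨e, he⟩, hue, rfl⟩
      obtain ⟨w, rfl⟩ := Sym2.mem_iff_exists.1 hue
      exact ⟨w, he, (hp u w he).symm⟩
    · rintro ⟨w, hw, rfl⟩
      exact ⟨⟨s(u, w), hw⟩, Sym2.mem_mk_left u w, (hp u w hw).symm⟩
  refine ⟨p, x0, y0, z0, ?_, ?_, ?_, ?_, ?_⟩
  · intro e e' hee
    obtain ⟨u, v, h, rfl⟩ := hedge e
    obtain ⟨u', v', h', rfl⟩ := hedge e'
    rw [hp u v h, hp u' v' h'] at hee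
    exact Subtype.ext (hinj u v u' v' h h' hee)
  · intro e
    obtain ⟨u, v, h, rfl⟩ := hedge e
    refine ⟨X u v, Y u v, Z u v, ?_, ?_, ?_, (hX u v h).1, (hX u v h).2, (hY u v h).1,
      (hY u v h).2, (hZ u v h).1, (hZ u v h).2⟩ <;> rw [hp u v h, hpt] <;> simp [gridPoint]
  · intro v
    obtain ⟨w, hw, hadj, hall, h⟩ := haff v
    rw [← affineIndependent_equiv (Equiv.ofBijective _ (bijective_incidentEdge v w hw hadj hall))]
    convert h using 2 with i
    exact hp v (w i) (hadj i)
  · intro u v huv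
    rw [hset, hset, hp u v huv]
    refine Set.Subset.antisymm (fun x hx => (hsep u v huv.ne x hx.1 hx.2).2) ?_
    rw [Set.singleton_subset_iff]
    exact ⟨subset_convexHull ℝ _ ⟨v, huv, rfl⟩,
      subset_convexHull ℝ _ ⟨u, huv.symm, (hsymm u v huv).symm⟩⟩
  · intro u v hne huv
    rw [hset, hset]
    exact Set.eq_empty_of_forall_notMem fun x hx => huv (hsep u v hne x hx.1 hx.2).1

/-- Combinatorial data placing the triangles of a cubic graph. The vertices in `A` become
triangles lying above a convex polygonal curve, at heights given by `lev`; the remaining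
vertices become vertical triangles below the curve and touching it, arranged in blocks of two
columns on edges of the curve. The edge of the curve carrying `b` lies on the line
`y = slope b * x + icpt (slope b)`. A vertex shares its side with at most one neighbour, its
`mate`; `outer v` is a neighbour of `v` on the other side. -/
structure TriangleLayout {V : Type*} (G : SimpleGraph V) where
  A : V → Prop
  mate : V → V
  outer : V → V
  right : V → Prop
  lev : V → ℤ
  start : V → ℤ
  slope : V → ℤ
  icpt : ℤ → ℤ
  mate_mate : ∀ v, mate (mate v) = v
  mate_mem : ∀ v, A (mate v) ↔ A v
  adj_mate : ∀ v, mate v ≠ v → G.Adj v (mate v)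
  eq_mate : ∀ v w, G.Adj v w → (A w ↔ A v) → w = mate v
  adj_outer : ∀ v, G.Adj v (outer v)
  outer_mem : ∀ v, A (outer v) ↔ ¬ A v
  lev_inj : ∀ a a', A a → A a' → lev a = lev a' → a = a'
  lev_mate : ∀ a, A a → mate a ≠ a → lev (mate a) = lev a + 1 ∨ lev a = lev (mate a) + 1
  right_mate : ∀ b, mate b ≠ b → (right (mate b) ↔ ¬ right b)
  start_mate : ∀ b, start (mate b) = start b
  slope_mate : ∀ b, slope (mate b) = slope b
  start_sep : ∀ b w, ¬ A b → ¬ A w → w ≠ b → w ≠ mate b →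
    start b + 2 ≤ start w ∨ start w + 2 ≤ start b
  slope_ne : ∀ a b w, A a → G.Adj a b → G.Adj a w → ¬ A b → ¬ A w → w ≠ b → w ≠ mate b →
    slope b ≠ slope w
  line_lt : ∀ b w x, ¬ A b → ¬ A w → slope b ≠ slope w → start w ≤ x → x ≤ start w + 1 →
    slope b * x + icpt (slope b) < slope w * x + icpt (slope w)

namespace TriangleLayout

variable {V : Type*} {G : SimpleGraph V} (L : TriangleLayout G)

open Classical in
/-- The column of the contact point of `a` in `A` and `b` outside `A`. -/
noncomputable def col (a b : V) : ℤ :=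
  if (L.mate b = b ∧ a = L.outer b) ∨ (L.mate b ≠ b ∧ L.right b) then L.start b + 1
  else L.start b

/-- The line carrying the edge of the curve on which `b` lies. -/
def height (b : V) (x : ℤ) : ℤ := L.slope b * x + L.icpt (L.slope b)

open Classical in
/-- The one of `u` and its mate that has the larger level. -/
noncomputable def upper (u : V) : V := if L.lev u < L.lev (L.mate u) then L.mate u else u

open Classical in
/-- The coordinates of the contact point of two adjacent vertices. -/
noncomputable def coord (u v : V) : ℤ × ℤ × ℤ :=
  if L.A u then
    if L.A v then
      (L.col (L.upper u) (L.outer (L.upper u)),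
        L.height (L.outer (L.upper u)) (L.col (L.upper u) (L.outer (L.upper u))) + 1,
        L.lev (L.upper u))
    else (L.col u v, L.height v (L.col u v), L.lev u)
  else
    if L.A v then (L.col v u, L.height u (L.col v u), L.lev v)
    else (L.start u, L.height u (L.start u) - 1, 0)

/-- The contact point of two adjacent vertices. -/
noncomputable def pt (u v : V) : EuclideanSpace ℝ (Fin 3) :=
  gridPoint (L.coord u v).1 (L.coord u v).2.1 (L.coord u v).2.2

variable {L} {a b u v w : V}

theorem coord_cross (ha : L.A a) (hb : ¬ L.A b) :
    L.coord a b = (L.col a b, L.height b (L.col a b), L.lev a) := by simp [coord, ha, hb]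

theorem coord_cross' (ha : L.A a) (hb : ¬ L.A b) :
    L.coord b a = (L.col a b, L.height b (L.col a b), L.lev a) := by simp [coord, ha, hb]

theorem coord_above (hu : L.A u) (hv : L.A v) :
    L.coord u v = (L.col (L.upper u) (L.outer (L.upper u)),
        L.height (L.outer (L.upper u)) (L.col (L.upper u) (L.outer (L.upper u))) + 1,
        L.lev (L.upper u)) := by simp [coord, hu, hv]

theorem coord_below (hu : ¬ L.A u) (hv : ¬ L.A v) :
    L.coord u v = (L.start u, L.height u (L.start u) - 1, 0) := by simp [coord, hu, hv]

theorem linearForm_pt (α β γ : ℝ) : linearForm α β γ (L.pt u v) =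
    α * (L.coord u v).1 + β * (L.coord u v).2.1 + γ * (L.coord u v).2.2 :=
  linearForm_gridPoint ..

theorem pt_eq_iff {u' v' : V} : L.pt u v = L.pt u' v' ↔ L.coord u v = L.coord u' v' := by
  rw [pt, pt, gridPoint_inj, Prod.ext_iff, Prod.ext_iff]

theorem start_le_col : L.start b ≤ L.col a b := by
  unfold col; split_ifs <;> omega

theorem col_le : L.col a b ≤ L.start b + 1 := by
  unfold col; split_ifs <;> omega

theorem height_mate (x : ℤ) : L.height (L.mate b) x = L.height b x := by
  simp [height, L.slope_mate]

theorem col_of_right (hb : L.mate b ≠ b) (h : L.right b) : L.col a b = L.start b + 1 := by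
  simp [col, hb, h]

theorem col_of_not_right (hb : L.mate b ≠ b) (h : ¬ L.right b) : L.col a b = L.start b := by
  simp [col, hb, h]

theorem mate_eq (h : G.Adj u v) (hs : L.A u ↔ L.A v) : L.mate u = v :=
  (L.eq_mate u v h hs.symm).symm

theorem col_mate_ne (hb : L.mate b ≠ b) : L.col u (L.mate b) ≠ L.col v b := by
  have hb' : L.mate (L.mate b) ≠ L.mate b := by rw [L.mate_mate]; exact hb.symm
  have := L.start_mate b
  by_cases h : L.right b
  · rw [col_of_right hb h, col_of_not_right hb' (by rw [L.right_mate b hb]; exact not_not.2 h)]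
    omega
  · rw [col_of_not_right hb h, col_of_right hb' ((L.right_mate b hb).2 h)]
    omega

theorem upper_eq (u : V) : L.upper u = u ∨ L.upper u = L.mate u := by
  unfold upper; split_ifs <;> simp

theorem upper_mem : L.A (L.upper u) ↔ L.A u := by
  rcases L.upper_eq u with h | h <;> rw [h]
  exact L.mate_mem u

theorem lev_le_lev_upper : L.lev u ≤ L.lev (L.upper u) := by
  unfold upper; split_ifs <;> omega

theorem upper_mate (hu : L.A u) : L.upper (L.mate u) = L.upper u := by
  by_cases h : L.mate u = u
  · rw [h]
  · have := L.lev_mate u hu h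
    unfold upper
    rw [L.mate_mate]
    split_ifs <;> first | rfl | omega

theorem outer_upper_mem (hu : L.A u) : ¬ L.A (L.outer (L.upper u)) := by
  rw [L.outer_mem, upper_mem]; exact not_not.2 hu

theorem coord_symm (h : G.Adj u v) : L.coord u v = L.coord v u := by
  by_cases hu : L.A u <;> by_cases hv : L.A v
  · rw [coord_above hu hv, coord_above hv hu, ← mate_eq h (by tauto), upper_mate hu]
  · rw [coord_cross hu hv, coord_cross' hu hv]
  · rw [coord_cross' hv hu, coord_cross hv hu]
  · rw [coord_below hu hv, coord_below hv hu, ← mate_eq h (by tauto), L.start_mate, height_mate]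

theorem eq_or_eq_mate_of_column {x : ℤ} (hb : ¬ L.A b) (hw : ¬ L.A w) (h1 : L.start b ≤ x)
    (h2 : x ≤ L.start b + 1) (h3 : L.start w ≤ x) (h4 : x ≤ L.start w + 1) :
    w = b ∨ w = L.mate b := by
  by_contra! h
  have := L.start_sep b w hb hw h.1 h.2
  omega

theorem height_eq_of_column {x : ℤ} (hb : ¬ L.A b) (hw : ¬ L.A w) (h1 : L.start b ≤ x)
    (h2 : x ≤ L.start b + 1) (h3 : L.start w ≤ x) (h4 : x ≤ L.start w + 1) :
    L.height w x = L.height b x := by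
  rcases eq_or_eq_mate_of_column hb hw h1 h2 h3 h4 with rfl | rfl
  · rfl
  · exact height_mate x

theorem col_ne (hb : ¬ L.A b) (hw : ¬ L.A w) (h : b ≠ w) : L.col u b ≠ L.col v w := by
  intro hcol
  have h1 : L.start w ≤ L.col v w := start_le_col
  have h2 : L.col v w ≤ L.start w + 1 := col_le
  rcases eq_or_eq_mate_of_column hb hw (start_le_col (a := u)) col_le (by omega)
    (by omega) with rfl | rfl
  · exact h rfl
  · exact col_mate_ne (fun hb' => h hb'.symm) hcol.symm

open Classical in
/-- The vertical offset from the curve of the contact point of `u` and `v`. -/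
noncomputable def offset (L : TriangleLayout G) (u v : V) : ℤ :=
  (if L.A u then 1 else 0) + (if L.A v then 1 else 0) - 1

theorem exists_column (u v : V) : ∃ b, ¬ L.A b ∧ L.start b ≤ (L.coord u v).1 ∧
    (L.coord u v).1 ≤ L.start b + 1 ∧
    (L.coord u v).2.1 = L.height b (L.coord u v).1 + L.offset u v := by
  by_cases hu : L.A u <;> by_cases hv : L.A v
  · exact ⟨_, outer_upper_mem hu, by simp [coord_above hu hv, start_le_col, col_le, offset, hu, hv]⟩
  · exact ⟨v, hv, by simp [coord_cross hu hv, start_le_col, col_le, offset, hu, hv]⟩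
  · exact ⟨u, hu, by simp [coord_cross' hv hu, start_le_col, col_le, offset, hu, hv]⟩
  · exact ⟨u, hu, by simp [coord_below hu hv, offset, hu, hv]; omega⟩

theorem offset_eq_of_coord_eq {u' v' : V} (h : L.coord u v = L.coord u' v') :
    L.offset u v = L.offset u' v' := by
  obtain ⟨b, hb, h1, h2, h3⟩ := L.exists_column u v
  obtain ⟨b', hb', h1', h2', h3'⟩ := L.exists_column u' v'
  rw [h] at h1 h2 h3
  have := height_eq_of_column hb hb' h1 h2 h1' h2'
  omega

theorem sym2_upper (h : G.Adj u v) (hs : L.A u ↔ L.A v) :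
    s(u, v) = s(L.upper u, L.mate (L.upper u)) := by
  rw [← mate_eq h hs]
  rcases L.upper_eq u with h | h <;> rw [h]
  rw [L.mate_mate]; exact Sym2.eq_swap

theorem sym2_eq_of_coord_eq_aux {u' v' : V} (h : G.Adj u v) (h' : G.Adj u' v')
    (hc : L.coord u v = L.coord u' v') (hu : L.A u ∨ ¬ L.A v) (hu' : L.A u' ∨ ¬ L.A v') :
    s(u, v) = s(u', v') := by
  have hoff := offset_eq_of_coord_eq hc
  by_cases hu1 : L.A u <;> by_cases hv1 : L.A v <;> by_cases hu2 : L.A u' <;>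
    by_cases hv2 : L.A v' <;> simp only [offset, hu1, hv1, hu2, hv2, if_true, if_false] at hoff <;>
    first | omega | (exfalso; tauto) | skip
  · rw [coord_above hu1 hv1, coord_above hu2 hv2] at hc
    simp only [Prod.mk.injEq] at hc
    rw [sym2_upper h (by tauto), sym2_upper h' (by tauto),
      L.lev_inj _ _ (upper_mem.2 hu1) (upper_mem.2 hu2) hc.2.2]
  · rw [coord_cross hu1 hv1, coord_cross hu2 hv2] at hc
    simp only [Prod.mk.injEq] at hc
    have hv : v = v' := by
      by_contra hne
      exact col_ne hv1 hv2 hne hc.1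
    rw [L.lev_inj _ _ hu1 hu2 hc.2.2, hv]
  · rw [coord_below hu1 hv1, coord_below hu2 hv2] at hc
    simp only [Prod.mk.injEq] at hc
    rw [← mate_eq h (by tauto), ← mate_eq h' (by tauto)]
    rcases eq_or_eq_mate_of_column hu1 hu2 le_rfl (by omega) hc.1.ge (by omega) with rfl | rfl
    · rfl
    · rw [L.mate_mate]; exact Sym2.eq_swap

theorem sym2_eq_of_coord_eq {u' v' : V} (h : G.Adj u v) (h' : G.Adj u' v')
    (hc : L.coord u v = L.coord u' v') : s(u, v) = s(u', v') := by
  have key : ∀ u v, G.Adj u v → ∃ x y, G.Adj x y ∧ s(u, v) = s(x, y) ∧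
      L.coord u v = L.coord x y ∧ (L.A x ∨ ¬ L.A y) := by
    intro u v h
    by_cases hu : L.A u ∨ ¬ L.A v
    · exact ⟨u, v, h, rfl, rfl, hu⟩
    · exact ⟨v, u, h.symm, Sym2.eq_swap, coord_symm h, by tauto⟩
  obtain ⟨x, y, hxy, e, c, hx⟩ := key u v h
  obtain ⟨x', y', hxy', e', c', hx'⟩ := key u' v' h'
  rw [e, e']
  exact sym2_eq_of_coord_eq_aux hxy hxy' (by rw [← c, ← c', hc]) hx hx'

/-- The triangle of a vertex. -/
def triangle (L : TriangleLayout G) (u : V) : Set (EuclideanSpace ℝ (Fin 3)) :=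
  convexHull ℝ (L.pt u '' {w | G.Adj u w})

theorem inter_above {x : EuclideanSpace ℝ (Fin 3)} (hu : L.A u) (hv : L.A v)
    (huv : L.lev u < L.lev v) (hxu : x ∈ L.triangle u) (hxv : x ∈ L.triangle v) :
    G.Adj u v ∧ x = L.pt u v := by
  have hz : ∀ {u w}, L.A u → (L.coord u w).2.2 = L.lev u ∨
      (L.A w ∧ (L.coord u w).2.2 = L.lev (L.upper u)) := by
    intro u w hu
    by_cases hw : L.A w
    · exact Or.inr ⟨hw, by rw [coord_above hu hw]⟩
    · exact Or.inl (by rw [coord_cross hu hw])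
  have hup : L.upper u = u ∨ L.upper u = v ∨ L.lev (L.upper u) < L.lev v := by
    rcases L.upper_eq u with h | h
    · exact Or.inl h
    · by_cases hm : L.mate u = u
      · exact Or.inl (h.trans hm)
      · by_cases hmv : L.mate u = v
        · exact Or.inr (Or.inl (h.trans hmv))
        · have h1 := L.lev_mate u hu hm
          have h2 : L.lev (L.mate u) ≠ L.lev v :=
            fun h' => hmv (L.lev_inj _ _ ((L.mate_mem u).2 hu) hv h')
          rw [h]; omega
  have hle : L.lev (L.upper u) ≤ L.lev v := by
    rcases hup with h | h | h
    · rw [h]; exact huv.le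
    · rw [h]
    · exact h.le
  have hI : ∀ w ∈ {w | G.Adj u w}, linearForm 0 0 1 (L.pt u w) ≤ (L.lev v) := by
    intro w _
    rw [linearForm_pt]
    simp only [zero_mul, zero_add, one_mul, Int.cast_le]
    rcases hz (w := w) hu with h | ⟨-, h⟩ <;> omega
  have hJ : ∀ w ∈ {w | G.Adj v w}, (L.lev v) ≤ linearForm 0 0 1 (L.pt v w) := by
    intro w _
    rw [linearForm_pt]
    simp only [zero_mul, zero_add, one_mul, Int.cast_le]
    have := L.lev_le_lev_upper (u := v)
    rcases hz (w := w) hv with h | ⟨-, h⟩ <;> omega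
  obtain ⟨h1, -⟩ := mem_convexHull_image_faces _ _ hI hJ hxu hxv
  refine eq_of_mem_convexHull_image ?_ h1
  rintro w ⟨huw, hw⟩
  rw [linearForm_pt] at hw
  simp only [zero_mul, zero_add, one_mul, Int.cast_inj] at hw
  rcases hz (w := w) hu with h | ⟨hwA, h⟩
  · omega
  · have : L.upper u = v := L.lev_inj _ _ (upper_mem.2 hu) hv (by omega)
    have hmw := mate_eq huw (by tauto)
    have : w = v := by
      rcases L.upper_eq u with h' | h'
      · rw [this] at h'; rw [h'] at huv; omega
      · rw [← hmw, ← h', this]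
    subst this
    exact ⟨huw, rfl⟩

theorem start_le_coord (hu : ¬ L.A u) : L.start u ≤ (L.coord u w).1 := by
  by_cases hw : L.A w
  · rw [coord_cross' hw hu]; exact start_le_col
  · rw [coord_below hu hw]

theorem coord_le_start (hu : ¬ L.A u) : (L.coord u w).1 ≤ L.start u + 1 := by
  by_cases hw : L.A w
  · rw [coord_cross' hw hu]; exact col_le
  · rw [coord_below hu hw]; simp

theorem inter_below_mate {x : EuclideanSpace ℝ (Fin 3)} (hu : ¬ L.A u) (hm : L.mate u ≠ u)
    (hr : ¬ L.right u) (hxu : x ∈ L.triangle u) (hxv : x ∈ L.triangle (L.mate u)) :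
    G.Adj u (L.mate u) ∧ x = L.pt u (L.mate u) := by
  have hmu : ¬ L.A (L.mate u) := by rwa [L.mate_mem]
  have hm' : L.mate (L.mate u) ≠ L.mate u := by rw [L.mate_mate]; exact hm.symm
  have hr' : L.right (L.mate u) := (L.right_mate u hm).2 hr
  have hst := L.start_mate u
  have hI : ∀ w ∈ {w | G.Adj u w}, linearForm 1 0 0 (L.pt u w) ≤ (L.start u) := by
    intro w _
    rw [linearForm_pt]
    simp only [zero_mul, add_zero, one_mul, Int.cast_le]
    by_cases hw : L.A w
    · rw [coord_cross' hw hu, col_of_not_right hm hr]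
    · rw [coord_below hu hw]
  have hJ : ∀ w ∈ {w | G.Adj (L.mate u) w}, (L.start u) ≤ linearForm 1 0 0 (L.pt (L.mate u) w) := by
    intro w _
    rw [linearForm_pt]
    simp only [zero_mul, add_zero, one_mul, Int.cast_le]
    rw [← hst]
    exact start_le_coord hmu
  obtain ⟨-, h1⟩ := mem_convexHull_image_faces _ _ hI hJ hxu hxv
  refine eq_of_mem_convexHull_image ?_ h1
  rintro w ⟨huw, hw⟩
  rw [linearForm_pt] at hw
  simp only [zero_mul, add_zero, one_mul, Int.cast_inj] at hw
  refine ⟨L.adj_mate u hm, ?_⟩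
  have hwA : ¬ L.A w := by
    intro hwA
    rw [coord_cross' hwA hmu, col_of_right hm' hr'] at hw
    simp only at hw
    omega
  have : w = u := by rw [← mate_eq huw (by tauto), L.mate_mate]
  subst this
  rw [pt_eq_iff, coord_symm huw]

theorem inter_below_of_start_lt {x : EuclideanSpace ℝ (Fin 3)} (hu : ¬ L.A u) (hv : ¬ L.A v)
    (h : L.start u + 2 ≤ L.start v) (hxu : x ∈ L.triangle u) (hxv : x ∈ L.triangle v) :
    False := by
  have hI : ∀ w ∈ {w | G.Adj u w}, linearForm 1 0 0 (L.pt u w) ≤ (L.start v) := by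
    intro w _
    rw [linearForm_pt]
    simp only [zero_mul, add_zero, one_mul, Int.cast_le]
    have := L.coord_le_start (w := w) hu
    omega
  have hJ : ∀ w ∈ {w | G.Adj v w}, (L.start v) ≤ linearForm 1 0 0 (L.pt v w) := by
    intro w _
    rw [linearForm_pt]
    simp only [zero_mul, add_zero, one_mul, Int.cast_le]
    exact start_le_coord hv
  obtain ⟨h1, -⟩ := mem_convexHull_image_faces _ _ hI hJ hxu hxv
  refine (eq_of_mem_convexHull_image (p := x) ?_ h1).1
  rintro w ⟨-, hw⟩
  rw [linearForm_pt] at hw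
  simp only [zero_mul, add_zero, one_mul, Int.cast_inj] at hw
  have := L.coord_le_start (w := w) hu
  omega

/-- The functional vanishing on the edge of the curve at `b`, negative above the curve. -/
noncomputable def support (L : TriangleLayout G) (b : V) : EuclideanSpace ℝ (Fin 3) →ₗ[ℝ] ℝ :=
  linearForm (L.slope b) (-1) 0

theorem support_pt : L.support b (L.pt u v) =
    ((L.height b (L.coord u v).1 - (L.coord u v).2.1 - L.icpt (L.slope b) : ℤ) : ℝ) := by
  rw [support, linearForm_pt, height]
  push_cast
  ring

theorem height_le {x : ℤ} (hb : ¬ L.A b) (hw : ¬ L.A w) (h1 : L.start w ≤ x)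
    (h2 : x ≤ L.start w + 1) : L.height b x ≤ L.height w x := by
  by_cases h : L.slope b = L.slope w
  · rw [height, height, h]
  · exact (L.line_lt b w x hb hw h h1 h2).le

theorem height_lt {x : ℤ} (hb : ¬ L.A b) (hw : ¬ L.A w) (h : L.slope b ≠ L.slope w)
    (h1 : L.start w ≤ x) (h2 : x ≤ L.start w + 1) : L.height b x < L.height w x :=
  L.line_lt b w x hb hw h h1 h2

theorem inter_faces {x : EuclideanSpace ℝ (Fin 3)} (ha : L.A a) (hb : ¬ L.A b)
    (hxa : x ∈ L.triangle a) (hxb : x ∈ L.triangle b) :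
    x ∈ convexHull ℝ (L.pt a '' {w | G.Adj a w ∧ ¬ L.A w ∧ L.slope w = L.slope b}) ∧
      x ∈ convexHull ℝ (L.pt b '' {w | G.Adj b w ∧ L.A w}) := by
  have hI : ∀ w ∈ {w | G.Adj a w}, L.support b (L.pt a w) ≤ (-L.icpt (L.slope b) : ℤ) := by
    intro w _
    rw [support_pt, Int.cast_le]
    by_cases hwA : L.A w
    · rw [coord_above ha hwA]
      have := height_le hb (outer_upper_mem ha) (start_le_col (L := L) (a := L.upper a)) col_le
      simp only
      omega
    · rw [coord_cross ha hwA]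
      have := height_le hb hwA (start_le_col (L := L) (a := a)) col_le
      simp only
      omega
  have hJ : ∀ w ∈ {w | G.Adj b w}, (-L.icpt (L.slope b) : ℤ) ≤ L.support b (L.pt b w) := by
    intro w _
    rw [support_pt, Int.cast_le]
    by_cases hwA : L.A w
    · rw [coord_cross' hwA hb]
      simp only
      omega
    · rw [coord_below hb hwA]
      simp only
      omega
  obtain ⟨h1, h2⟩ := mem_convexHull_image_faces _ _ hI hJ hxa hxb
  refine ⟨convexHull_mono (Set.image_mono ?_) h1, convexHull_mono (Set.image_mono ?_) h2⟩
  · rintro w ⟨haw, hw⟩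
    rw [support_pt, Int.cast_inj] at hw
    have hwA : ¬ L.A w := by
      intro hwA
      rw [coord_above ha hwA] at hw
      have := height_le hb (outer_upper_mem ha) (start_le_col (L := L) (a := L.upper a)) col_le
      simp only at hw
      omega
    refine ⟨haw, hwA, ?_⟩
    by_contra hne
    rw [coord_cross ha hwA] at hw
    have := height_lt hb hwA (Ne.symm hne) (start_le_col (L := L) (a := a)) col_le
    simp only at hw
    omega
  · rintro w ⟨hbw, hw⟩
    rw [support_pt, Int.cast_inj] at hw
    refine ⟨hbw, ?_⟩
    by_contra hwA
    rw [coord_below hb hwA] at hw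
    simp only at hw
    omega

theorem inter_cross {x : EuclideanSpace ℝ (Fin 3)} (ha : L.A a) (hb : ¬ L.A b)
    (hxa : x ∈ L.triangle a) (hxb : x ∈ L.triangle b) : G.Adj a b ∧ x = L.pt a b := by
  obtain ⟨h1, h2⟩ := inter_faces ha hb hxa hxb
  -- it suffices to find a functional that separates the two faces except at the contact point
  have separate : ∀ (ε : ℝ) (c : ℤ),
      (∀ w, G.Adj a w → ¬ L.A w → L.slope w = L.slope b → ε * L.col a w ≤ ε * c) →
      (∀ w, G.Adj b w → L.A w → ε * c ≤ ε * L.col w b) →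
      (∀ w, G.Adj a w → ¬ L.A w → L.slope w = L.slope b → ε * L.col a w = ε * c → w = b) →
      G.Adj a b ∧ x = L.pt a b := by
    intro ε c k1 k2 k3
    have hI : ∀ w ∈ {w | G.Adj a w ∧ ¬ L.A w ∧ L.slope w = L.slope b},
        linearForm ε 0 0 (L.pt a w) ≤ ε * c := by
      rintro w ⟨haw, hwA, hs⟩
      rw [linearForm_pt, coord_cross ha hwA]
      simpa using k1 w haw hwA hs
    have hJ : ∀ w ∈ {w | G.Adj b w ∧ L.A w}, ε * c ≤ linearForm ε 0 0 (L.pt b w) := by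
      rintro w ⟨hbw, hwA⟩
      rw [linearForm_pt, coord_cross' hwA hb]
      simpa using k2 w hbw hwA
    obtain ⟨h3, -⟩ := mem_convexHull_image_faces _ _ hI hJ h1 h2
    refine eq_of_mem_convexHull_image ?_ h3
    rintro w ⟨⟨haw, hwA, hs⟩, hw⟩
    rw [linearForm_pt, coord_cross ha hwA] at hw
    obtain rfl := k3 w haw hwA hs (by simpa using hw)
    exact ⟨haw, rfl⟩
  by_cases hfar : ∃ w, G.Adj a w ∧ ¬ L.A w ∧ L.slope w = L.slope b ∧ w ≠ b ∧ w ≠ L.mate b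
  · obtain ⟨w, haw, hwA, hs, hwb, hwm⟩ := hfar
    have hblock : ∀ w', G.Adj a w' → ¬ L.A w' → L.slope w' = L.slope b →
        L.start w' = L.start w := by
      intro w' haw' hwA' hs'
      by_contra hne
      refine L.slope_ne a w w' ha haw haw' hwA hwA' ?_ ?_ (hs.trans hs'.symm)
      · rintro rfl; exact hne rfl
      · rintro rfl; exact hne (L.start_mate w)
    rcases L.start_sep b w hb hwA hwb hwm with h | h
    · refine separate (-1) (L.start b + 1) ?_ ?_ ?_
      · intro w' h1 h2 h3
        have := hblock w' h1 h2 h3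
        have := start_le_col (L := L) (a := a) (b := w')
        rw [neg_one_mul, neg_one_mul, neg_le_neg_iff, Int.cast_le]
        omega
      · intro w' _ _
        have := col_le (L := L) (a := w') (b := b)
        rw [neg_one_mul, neg_one_mul, neg_le_neg_iff, Int.cast_le]
        omega
      · intro w' h1 h2 h3 h4
        have := hblock w' h1 h2 h3
        have := start_le_col (L := L) (a := a) (b := w')
        rw [neg_one_mul, neg_one_mul, neg_inj, Int.cast_inj] at h4
        omega
    · refine separate 1 (L.start b) ?_ ?_ ?_
      · intro w' h1 h2 h3
        have := hblock w' h1 h2 h3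
        have := col_le (L := L) (a := a) (b := w')
        rw [one_mul, one_mul, Int.cast_le]
        omega
      · intro w' _ _
        have := start_le_col (L := L) (a := w') (b := b)
        rw [one_mul, one_mul, Int.cast_le]
        omega
      · intro w' h1 h2 h3 h4
        have := hblock w' h1 h2 h3
        have := col_le (L := L) (a := a) (b := w')
        rw [one_mul, one_mul, Int.cast_inj] at h4
        omega
  · push Not at hfar
    have hstart : ∀ w, G.Adj a w → ¬ L.A w → L.slope w = L.slope b →
        L.start w = L.start b := by
      intro w h1 h2 h3
      by_cases hwb : w = b
      · rw [hwb]
      · rw [hfar w h1 h2 h3 hwb, L.start_mate]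
    by_cases hm : L.mate b = b
    · refine separate 0 0 (by simp) (by simp) ?_
      intro w h1 h2 h3 _
      by_contra hwb
      exact hwb ((hfar w h1 h2 h3 hwb).trans hm)
    by_cases hr : L.right b
    · refine separate 1 (L.start b + 1) ?_ ?_ ?_
      · intro w h1 h2 h3
        rw [one_mul, one_mul, Int.cast_le, ← hstart w h1 h2 h3]
        exact col_le
      · intro w _ _
        rw [col_of_right hm hr]
      · intro w h1 h2 h3 h4
        rw [one_mul, one_mul, Int.cast_inj, ← col_of_right (a := a) hm hr] at h4
        by_contra hwb
        rw [hfar w h1 h2 h3 hwb] at h4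
        exact col_mate_ne hm h4
    · refine separate (-1) (L.start b) ?_ ?_ ?_
      · intro w h1 h2 h3
        rw [neg_one_mul, neg_one_mul, neg_le_neg_iff, Int.cast_le, ← hstart w h1 h2 h3]
        exact start_le_col
      · intro w _ _
        rw [col_of_not_right hm hr]
      · intro w h1 h2 h3 h4
        rw [neg_one_mul, neg_one_mul, neg_inj, Int.cast_inj,
          ← col_of_not_right (a := a) hm hr] at h4
        by_contra hwb
        rw [hfar w h1 h2 h3 hwb] at h4
        exact col_mate_ne hm h4

theorem inter_triangle {x : EuclideanSpace ℝ (Fin 3)} (huv : u ≠ v) (hxu : x ∈ L.triangle u)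
    (hxv : x ∈ L.triangle v) : G.Adj u v ∧ x = L.pt u v := by
  have hswap : G.Adj v u ∧ x = L.pt v u → G.Adj u v ∧ x = L.pt u v := by
    rintro ⟨h, rfl⟩
    exact ⟨h.symm, pt_eq_iff.2 (coord_symm h)⟩
  by_cases hu : L.A u <;> by_cases hv : L.A v
  · rcases lt_trichotomy (L.lev u) (L.lev v) with h | h | h
    · exact inter_above hu hv h hxu hxv
    · exact absurd (L.lev_inj u v hu hv h) huv
    · exact hswap (inter_above hv hu h hxv hxu)
  · exact inter_cross hu hv hxu hxv
  · exact hswap (inter_cross hv hu hxv hxu)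
  · by_cases hm : v = L.mate u
    · subst hm
      by_cases hr : L.right u
      · refine hswap ?_
        have := inter_below_mate (L := L) (u := L.mate u) (x := x) hv
        rw [L.mate_mate] at this
        exact this huv (by rw [L.right_mate u huv.symm]; exact not_not.2 hr) hxv hxu
      · exact inter_below_mate hu huv.symm hr hxu hxv
    · rcases L.start_sep u v hu hv huv.symm hm with h | h
      · exact (inter_below_of_start_lt hu hv h hxu hxv).elim
      · exact (inter_below_of_start_lt hv hu h hxv hxu).elim

theorem exists_two_other_neighbors [Fintype V] [DecidableEq V] [DecidableRel G.Adj]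
    (hd : G.degree v = 3) (h : G.Adj v u) :
    ∃ x y, G.Adj v x ∧ G.Adj v y ∧ x ≠ y ∧ u ≠ x ∧ u ≠ y := by
  have hc : ((G.neighborFinset v).erase u).card = 2 := by
    rw [Finset.card_erase_of_mem (by simpa using h), G.card_neighborFinset_eq_degree, hd]
  obtain ⟨x, y, hxy, he⟩ := Finset.card_eq_two.1 hc
  have hx : x ∈ (G.neighborFinset v).erase u := by simp [he]
  have hy : y ∈ (G.neighborFinset v).erase u := by simp [he]
  simp only [Finset.mem_erase, SimpleGraph.mem_neighborFinset] at hx hy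
  exact ⟨x, y, hx.2, hy.2, hxy, hx.1.symm, hy.1.symm⟩

theorem exists_third_neighbor [Fintype V] [DecidableEq V] [DecidableRel G.Adj]
    (hd : G.degree v = 3) (h : G.Adj v u) (w : V) :
    ∃ x, G.Adj v x ∧ u ≠ x ∧ w ≠ x := by
  obtain ⟨x, y, hx, hy, hxy, hux, huy⟩ := exists_two_other_neighbors hd h
  by_cases hwx : w = x
  · exact ⟨y, hy, huy, fun hwy => hxy (hwx.symm.trans hwy)⟩
  · exact ⟨x, hx, hux, hwx⟩

theorem pt_cross (ha : L.A a) (hb : ¬ L.A b) (α β γ : ℝ) : linearForm α β γ (L.pt a b) =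
    α * L.col a b + β * L.height b (L.col a b) + γ * L.lev a := by
  rw [linearForm_pt, coord_cross ha hb]

theorem pt_cross' (ha : L.A a) (hb : ¬ L.A b) (α β γ : ℝ) : linearForm α β γ (L.pt b a) =
    α * L.col a b + β * L.height b (L.col a b) + γ * L.lev a := by
  rw [linearForm_pt, coord_cross' ha hb]

theorem col_eq_start (hm : L.mate b = b) (h : a ≠ L.outer b) : L.col a b = L.start b := by
  simp [col, hm, h]

theorem col_outer (hm : L.mate b = b) : L.col (L.outer b) b = L.start b + 1 := by
  simp [col, hm]

theorem mem_iff_of_ne_mate (h : G.Adj u v) (hv : v ≠ L.mate u) : L.A v ↔ ¬ L.A u := by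
  by_contra h'
  exact hv (L.eq_mate u v h (by tauto))

theorem support_pt_lt (hb : ¬ L.A b) (hw : ¬ L.A w) (ha : L.A a) (hs : L.slope b ≠ L.slope w) :
    L.support b (L.pt a w) < L.support b (L.pt a b) := by
  have := height_lt hb hw hs (start_le_col (L := L) (a := a)) col_le
  rw [support_pt, support_pt, coord_cross ha hw, coord_cross ha hb, Int.cast_lt]
  dsimp only
  omega

theorem support_pt_mate (hb : ¬ L.A b) (ha : L.A a) :
    L.support b (L.pt a b) = L.support b (L.pt a (L.mate b)) := by
  rw [support_pt, support_pt, coord_cross ha hb, coord_cross ha (by rwa [L.mate_mem]),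
    height_mate]
  simp

theorem exists_affineIndependent_below [Fintype V] [DecidableEq V] [DecidableRel G.Adj]
    (hd : G.degree v = 3) (hv : ¬ L.A v) : ∃ x y z, G.Adj v x ∧ G.Adj v y ∧ G.Adj v z ∧ x ≠ y ∧
      x ≠ z ∧ y ≠ z ∧ AffineIndependent ℝ ![L.pt v x, L.pt v y, L.pt v z] := by
  have hlev : ∀ {x y}, L.A x → L.A y → x ≠ y →
      linearForm 0 0 1 (L.pt v x) ≠ linearForm 0 0 1 (L.pt v y) := by
    intro x y hx hy hxy h
    rw [pt_cross' hx hv, pt_cross' hy hv] at h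
    exact hxy (L.lev_inj x y hx hy (by simpa using h))
  by_cases hm : L.mate v = v
  · obtain ⟨x, y, hx, hy, hxy, hox, hoy⟩ := exists_two_other_neighbors hd (L.adj_outer v)
    have hmem : ∀ {x}, G.Adj v x → L.A x := fun h =>
      (mem_iff_of_ne_mate h (by rw [hm]; exact h.ne')).2 hv
    refine ⟨x, y, L.outer v, hx, hy, L.adj_outer v, hxy, hox.symm, hoy.symm,
      affineIndependent_three_of_linearForm (linearForm 1 0 0) (linearForm 0 0 1) ?_ ?_
        (hlev (hmem hx) (hmem hy) hxy)⟩
    · rw [pt_cross' (hmem hx) hv, pt_cross' (hmem hy) hv, col_eq_start hm hox.symm,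
        col_eq_start hm hoy.symm]
      simp
    · rw [pt_cross' (hmem hx) hv, pt_cross' (hmem (L.adj_outer v)) hv,
        col_eq_start hm hox.symm, col_outer hm]
      simp
  · obtain ⟨x, y, hx, hy, hxy, hox, hoy⟩ := exists_two_other_neighbors hd (L.adj_mate v hm)
    have hxA := (mem_iff_of_ne_mate hx hox.symm).2 hv
    have hyA := (mem_iff_of_ne_mate hy hoy.symm).2 hv
    refine ⟨x, y, L.mate v, hx, hy, L.adj_mate v hm, hxy, hox.symm, hoy.symm,
      affineIndependent_three_of_linearForm (L.support v) (linearForm 0 0 1) ?_ ?_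
        (hlev hxA hyA hxy)⟩
    · rw [support_pt, support_pt, coord_cross' hxA hv, coord_cross' hyA hv]
      simp
    · rw [support_pt, support_pt, coord_cross' hxA hv, coord_below hv (by rwa [L.mate_mem]), Ne,
        Int.cast_inj]
      dsimp only
      omega

theorem exists_affineIndependent_above [Fintype V] [DecidableEq V] [DecidableRel G.Adj]
    (hd : G.degree v = 3) (hv : L.A v) : ∃ x y z, G.Adj v x ∧ G.Adj v y ∧ G.Adj v z ∧ x ≠ y ∧
      x ≠ z ∧ y ≠ z ∧ AffineIndependent ℝ ![L.pt v x, L.pt v y, L.pt v z] := by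
  have hnot : ∀ {x}, G.Adj v x → x ≠ L.mate v → ¬ L.A x := fun h hne hA =>
    (mem_iff_of_ne_mate h hne).1 hA hv
  have hcol : ∀ {x y}, ¬ L.A x → ¬ L.A y → x ≠ y →
      linearForm 1 0 0 (L.pt v x) ≠ linearForm 1 0 0 (L.pt v y) := by
    intro x y hx hy hxy h
    rw [pt_cross hv hx, pt_cross hv hy] at h
    exact col_ne hx hy hxy (by simpa using h)
  have ho : ¬ L.A (L.outer v) := by rw [L.outer_mem]; exact not_not.2 hv
  by_cases hm : L.mate v = v
  · have hmem : ∀ {x}, G.Adj v x → ¬ L.A x := fun h => hnot h (by rw [hm]; exact h.ne')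
    by_cases hpair : ∃ w, G.Adj v w ∧ G.Adj v (L.mate w) ∧ L.mate w ≠ w
    · obtain ⟨w, hw, hmw, hne⟩ := hpair
      obtain ⟨z, hz, hwz, hmz⟩ := exists_third_neighbor hd hw (L.mate w)
      refine ⟨w, L.mate w, z, hw, hmw, hz, hne.symm, hwz, hmz,
        affineIndependent_three_of_linearForm (L.support w) (linearForm 1 0 0)
          (support_pt_mate (hmem hw) hv) (support_pt_lt (hmem hw) (hmem hz) hv ?_).ne
          (hcol (hmem hw) (hmem hmw) hne.symm)⟩
      exact L.slope_ne v w z hv hw hz (hmem hw) (hmem hz) hwz.symm hmz.symm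
    · obtain ⟨x, y, hx, hy, hxy, hox, hoy⟩ := exists_two_other_neighbors hd (L.adj_outer v)
      have hs : ∀ {x y}, G.Adj v x → G.Adj v y → x ≠ y →
          (-L.support x) (L.pt v x) < (-L.support x) (L.pt v y) := by
        intro x y hx hy hxy
        rw [LinearMap.neg_apply, LinearMap.neg_apply, neg_lt_neg_iff]
        refine support_pt_lt (hmem hx) (hmem hy) hv
          (L.slope_ne v x y hv hx hy (hmem hx) (hmem hy) hxy.symm ?_)
        rintro rfl
        exact hpair ⟨x, hx, hy, hxy.symm⟩
      have hadj := L.adj_outer v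
      exact ⟨L.outer v, x, y, hadj, hx, hy, hox, hoy, hxy,
        affineIndependent_three_of_exposed _ _ _ (hs hadj hx hox) (hs hadj hy hoy)
          (hs hx hadj hox.symm) (hs hx hy hxy) (hs hy hadj hoy.symm) (hs hy hx hxy.symm)⟩
  · have hadj := L.adj_mate v hm
    have hmA : L.A (L.mate v) := (L.mate_mem v).2 hv
    by_cases hup : L.lev v < L.lev (L.mate v)
    · obtain ⟨x, y, hx, hy, hxy, hox, hoy⟩ := exists_two_other_neighbors hd hadj
      have hxA := hnot hx hox.symm
      have hyA := hnot hy hoy.symm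
      refine ⟨x, y, L.mate v, hx, hy, hadj, hxy, hox.symm, hoy.symm,
        affineIndependent_three_of_linearForm (linearForm 0 0 1) (linearForm 1 0 0) ?_ ?_
          (hcol hxA hyA hxy)⟩
      · rw [pt_cross hv hxA, pt_cross hv hyA]
        simp
      · rw [pt_cross hv hxA, linearForm_pt, coord_above hv hmA, upper, if_pos hup]
        simpa using hup.ne'
    · have hou : L.outer v ≠ L.mate v := fun h => ho (h ▸ hmA)
      obtain ⟨z, hz, hoz, hmz⟩ := exists_third_neighbor hd (L.adj_outer v) (L.mate v)
      refine ⟨L.outer v, L.mate v, z, L.adj_outer v, hadj, hz, hou, hoz, hmz,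
        affineIndependent_three_of_linearForm (linearForm 1 0 0) (linearForm 0 1 0) ?_
          (hcol (hnot hz hmz.symm) ho hoz.symm) ?_⟩
      · rw [pt_cross hv ho, linearForm_pt, coord_above hv hmA, upper, if_neg hup]
        simp
      · rw [pt_cross hv ho, linearForm_pt, coord_above hv hmA, upper, if_neg hup]
        simp

theorem exists_affineIndependent [Fintype V] [DecidableEq V] [DecidableRel G.Adj]
    (hd : G.degree v = 3) : ∃ w : Fin 3 → V, Function.Injective w ∧ (∀ i, G.Adj v (w i)) ∧
      (∀ u, G.Adj v u → ∃ i, u = w i) ∧ AffineIndependent ℝ (fun i => L.pt v (w i)) := by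
  obtain ⟨x, y, z, hx, hy, hz, hxy, hxz, hyz, haff⟩ : ∃ x y z, G.Adj v x ∧ G.Adj v y ∧
      G.Adj v z ∧ x ≠ y ∧ x ≠ z ∧ y ≠ z ∧
      AffineIndependent ℝ ![L.pt v x, L.pt v y, L.pt v z] := by
    by_cases hv : L.A v
    · exact exists_affineIndependent_above hd hv
    · exact exists_affineIndependent_below hd hv
  refine ⟨![x, y, z], ?_, ?_, ?_, ?_⟩
  · intro i j hij
    fin_cases i <;> fin_cases j <;> simp_all
  · intro i
    fin_cases i <;> assumption
  · have hN : {x, y, z} = G.neighborFinset v := by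
      refine Finset.eq_of_subset_of_card_le ?_ ?_
      · simp [Finset.insert_subset_iff, hx, hy, hz]
      · rw [G.card_neighborFinset_eq_degree, hd, Finset.card_eq_three.2 ⟨x, y, z, hxy, hxz, hyz, rfl⟩]
    intro u hu
    have : u ∈ ({x, y, z} : Finset V) := by rw [hN]; simpa using hu
    simp only [Finset.mem_insert, Finset.mem_singleton] at this
    rcases this with rfl | rfl | rfl
    exacts [⟨0, rfl⟩, ⟨1, rfl⟩, ⟨2, rfl⟩]
  · convert haff using 1
    ext i : 1
    fin_cases i <;> rfl

theorem exists_representation [Fintype V] [DecidableEq V] [DecidableRel G.Adj]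
    (L : TriangleLayout G) (hd : ∀ v, G.degree v = 3) (m k : ℕ) (x0 y0 : ℤ)
    (hx : ∀ b, ¬ L.A b → x0 ≤ L.start b ∧ L.start b + 1 < x0 + m)
    (hy : ∀ b x, ¬ L.A b → L.start b ≤ x → x ≤ L.start b + 1 →
      y0 < L.height b x ∧ L.height b x + 1 < y0 + m)
    (hz : ∀ a, L.A a → 0 ≤ L.lev a ∧ L.lev a < k) :
    ∃ (p : G.edgeSet → EuclideanSpace ℝ (Fin 3)) (x0 y0 z0 : ℤ),
      Function.Injective p ∧
      (∀ e : G.edgeSet, ∃ a b c : ℤ,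
        p e 0 = (a : ℝ) ∧ p e 1 = (b : ℝ) ∧ p e 2 = (c : ℝ) ∧
        x0 ≤ a ∧ a < x0 + m ∧ y0 ≤ b ∧ b < y0 + m ∧ z0 ≤ c ∧ c < z0 + k) ∧
      (∀ v : V, AffineIndependent ℝ
        (fun e : {e : G.edgeSet // v ∈ (e : Sym2 V)} => p e.1)) ∧
      (∀ u v (huv : G.Adj u v),
        convexHull ℝ {x | ∃ e : G.edgeSet, u ∈ (e : Sym2 V) ∧ x = p e} ∩
          convexHull ℝ {x | ∃ e : G.edgeSet, v ∈ (e : Sym2 V) ∧ x = p e} =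
          {p ⟨s(u, v), G.mem_edgeSet.mpr huv⟩}) ∧
      (∀ u v, u ≠ v → ¬ G.Adj u v →
        convexHull ℝ {x | ∃ e : G.edgeSet, u ∈ (e : Sym2 V) ∧ x = p e} ∩
          convexHull ℝ {x | ∃ e : G.edgeSet, v ∈ (e : Sym2 V) ∧ x = p e} = ∅) := by
  refine exists_representation_of_points G m k _ _ _ x0 y0 0 L.pt (fun _ _ => rfl)
    (fun u v h => pt_eq_iff.2 (coord_symm h))
    (fun u v u' v' h h' he => sym2_eq_of_coord_eq h h' (pt_eq_iff.1 he)) ?_ ?_ ?_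
    (fun v => exists_affineIndependent (hd v)) (fun u v huv x hu hv => inter_triangle huv hu hv)
  · intro u v _
    obtain ⟨b, hb, h1, h2, -⟩ := L.exists_column u v
    have := hx b hb
    omega
  · intro u v _
    obtain ⟨b, hb, h1, h2, h3⟩ := L.exists_column u v
    have := hy b _ hb h1 h2
    have h4 : -1 ≤ L.offset u v ∧ L.offset u v ≤ 1 := by
      unfold offset
      split_ifs <;> omega
    omega
  · intro u v _
    by_cases hu : L.A u <;> by_cases hv : L.A v
    · rw [coord_above hu hv]; simpa using hz _ (upper_mem.2 hu)
    · rw [coord_cross hu hv]; simpa using hz _ hu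
    · rw [coord_cross' hv hu]; simpa using hz _ hv
    · have := hz _ ((L.outer_mem u).2 hu)
      rw [coord_below hu hv]
      dsimp only
      omega

end TriangleLayout

section Cut

variable {V : Type*} [Fintype V] [DecidableEq V] (G : SimpleGraph V) [DecidableRel G.Adj]

/-- The effect on a symmetric double sum of changing one row and the corresponding column. -/
theorem sum_sum_sub_of_eq_off {F F' : V → V → ℤ} (v : V) (hF : ∀ u w, F u w = F w u)
    (hF' : ∀ u w, F' u w = F' w u) (hv : F' v v = F v v)
    (h : ∀ u w, u ≠ v → w ≠ v → F' u w = F u w) :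
    ∑ u, ∑ w, F' u w - ∑ u, ∑ w, F u w = 2 * (∑ w, F' v w - ∑ w, F v w) := by
  have key : ∀ u w, F' u w - F u w =
      (if u = v then F' v w - F v w else 0) + (if w = v then F' v u - F v u else 0) := by
    intro u w
    by_cases hu : u = v <;> by_cases hw : w = v
    · subst hu; subst hw; simp [hv]
    · subst hu; simp [hw]
    · subst hw; simp [hu, hF u, hF' u]
    · simp [hu, hw, h u w hu hw]
  simp only [← Finset.sum_sub_distrib]
  rw [Finset.sum_congr rfl fun u _ => Finset.sum_congr rfl fun w _ => key u w]
  simp only [Finset.sum_add_distrib]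
  rw [Finset.sum_comm]
  simp only [Finset.sum_ite_eq', Finset.mem_univ, if_true, Finset.sum_sub_distrib]
  ring

/-- In a cubic graph, there is a set of at most half of the vertices such that each vertex has at
most one neighbor on its own side. -/
theorem exists_cut_of_cubic (hd : ∀ v, G.degree v = 3) : ∃ A : Finset V,
    2 * A.card ≤ Fintype.card V ∧
    ∀ v, ((G.neighborFinset v).filter fun w => (w ∈ A ↔ v ∈ A)).card ≤ 1 := by
  obtain ⟨A, -, hA⟩ := Finset.exists_min_image (Finset.univ : Finset (Finset V))
    (fun A => ∑ u, ∑ w, if G.Adj u w ∧ (w ∈ A ↔ u ∈ A) then (1 : ℤ) else 0) ⟨∅, by simp⟩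
  have hone : ∀ v, ((G.neighborFinset v).filter fun w => (w ∈ A ↔ v ∈ A)).card ≤ 1 := by
    intro v
    set A' := symmDiff A {v} with hA'
    have hmem : ∀ w, w ≠ v → (w ∈ A' ↔ w ∈ A) := by
      intro w hw; simp [hA', Finset.mem_symmDiff, hw]
    have hmemv : v ∈ A' ↔ v ∉ A := by simp [hA', Finset.mem_symmDiff]
    have hcount : ∀ B : Finset V, ∑ w, (if G.Adj v w ∧ (w ∈ B ↔ v ∈ B) then (1 : ℤ) else 0) =
        ((G.neighborFinset v).filter fun w => (w ∈ B ↔ v ∈ B)).card := by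
      intro B
      rw [Finset.card_filter, Nat.cast_sum]
      simp only [SimpleGraph.neighborFinset_eq_filter, Finset.sum_filter]
      refine Finset.sum_congr rfl fun w _ => ?_
      by_cases h : G.Adj v w <;> simp [h]
    have hdiff := sum_sum_sub_of_eq_off v
      (F := fun u w => if G.Adj u w ∧ (w ∈ A ↔ u ∈ A) then (1 : ℤ) else 0)
      (F' := fun u w => if G.Adj u w ∧ (w ∈ A' ↔ u ∈ A') then (1 : ℤ) else 0)
      (fun u w => by simp only [G.adj_comm u w, iff_comm])
      (fun u w => by simp only [G.adj_comm u w, iff_comm]) (by simp)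
      (fun u w hu hw => by simp only [hmem u hu, hmem w hw])
    have hmin := hA A' (Finset.mem_univ _)
    have hflip : ((G.neighborFinset v).filter fun w => (w ∈ A' ↔ v ∈ A')) =
        (G.neighborFinset v).filter fun w => ¬ (w ∈ A ↔ v ∈ A) := by
      refine Finset.filter_congr fun w hw => ?_
      rw [hmem w (G.ne_of_adj (by simpa using hw)).symm, hmemv]
      tauto
    have hsplit := Finset.card_filter_add_card_filter_not (s := G.neighborFinset v)
      (fun w => (w ∈ A ↔ v ∈ A))
    rw [G.card_neighborFinset_eq_degree, hd] at hsplit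
    simp only [hcount] at hdiff
    rw [hflip] at hdiff
    omega
  by_cases h : 2 * A.card ≤ Fintype.card V
  · exact ⟨A, h, hone⟩
  · refine ⟨Aᶜ, by rw [Finset.card_compl]; omega, fun v => ?_⟩
    simpa only [Finset.mem_compl, not_iff_not] using hone v

/-- The set of `exists_cut_of_cubic`, together with, for each vertex, its neighbor on the same
side (or itself, if there is none) and a neighbor on the other side. -/
theorem exists_cut_mate_of_cubic (hd : ∀ v, G.degree v = 3) :
    ∃ (A : Finset V) (mate outer : V → V), 2 * A.card ≤ Fintype.card V ∧
    (∀ v, mate (mate v) = v) ∧ (∀ v, mate v ∈ A ↔ v ∈ A) ∧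
    (∀ v, mate v ≠ v → G.Adj v (mate v)) ∧
    (∀ v w, G.Adj v w → (w ∈ A ↔ v ∈ A) → w = mate v) ∧
    (∀ v, G.Adj v (outer v)) ∧ (∀ v, outer v ∈ A ↔ v ∉ A) := by
  obtain ⟨A, hA, hone⟩ := exists_cut_of_cubic G hd
  have huniq : ∀ v w w', G.Adj v w → (w ∈ A ↔ v ∈ A) → G.Adj v w' → (w' ∈ A ↔ v ∈ A) →
      w = w' := by
    intro v w w' h1 h2 h3 h4
    exact Finset.card_le_one.1 (hone v) w (by simp [h1, h2]) w' (by simp [h3, h4])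
  have hmate : ∀ v, ∃ w, (w ∈ A ↔ v ∈ A) ∧ (w ≠ v → G.Adj v w) ∧
      ∀ w', G.Adj v w' → (w' ∈ A ↔ v ∈ A) → w' = w := by
    intro v
    by_cases h : ∃ w, G.Adj v w ∧ (w ∈ A ↔ v ∈ A)
    · obtain ⟨w, h1, h2⟩ := h
      exact ⟨w, h2, fun _ => h1, fun w' h3 h4 => huniq v w' w h3 h4 h1 h2⟩
    · exact ⟨v, Iff.rfl, fun h' => absurd rfl h', fun w' h1 h2 => absurd ⟨w', h1, h2⟩ h⟩
  have houter : ∀ v, ∃ w, G.Adj v w ∧ (w ∈ A ↔ v ∉ A) := by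
    intro v
    have hsplit := Finset.card_filter_add_card_filter_not (s := G.neighborFinset v)
      (fun w => (w ∈ A ↔ v ∈ A))
    rw [G.card_neighborFinset_eq_degree, hd] at hsplit
    have := hone v
    obtain ⟨w, hw⟩ := Finset.card_pos.1
      (show 0 < ((G.neighborFinset v).filter fun w => ¬ (w ∈ A ↔ v ∈ A)).card by omega)
    simp only [Finset.mem_filter, SimpleGraph.mem_neighborFinset] at hw
    exact ⟨w, hw.1, by tauto⟩
  choose mate h1 h2 h3 using hmate
  choose outer h4 h5 using houter
  refine ⟨A, mate, outer, hA, fun v => ?_, h1, h2, h3, h4, h5⟩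
  by_cases h : mate v = v
  · rw [h, h]
  · exact (h3 (mate v) v (h2 v h).symm (h1 v).symm).symm

end Cut

section Rank

variable {V : Type*} {S : Finset V} {κ : V → ℤ} {a b : V}

theorem card_filter_lt_lt_card_filter_lt (ha : a ∈ S) (h : κ a < κ b) :
    (S.filter (κ · < κ a)).card < (S.filter (κ · < κ b)).card := by
  refine Finset.card_lt_card (Finset.ssubset_iff_of_subset ?_ |>.2 ⟨a, ?_, ?_⟩)
  · exact Finset.monotone_filter_right S fun x _ hx => lt_trans hx h
  · simp [ha, h]
  · simp

theorem card_filter_lt_injOn (hκ : Set.InjOn κ S) (ha : a ∈ S) (hb : b ∈ S)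
    (h : (S.filter (κ · < κ a)).card = (S.filter (κ · < κ b)).card) : a = b := by
  rcases lt_trichotomy (κ a) (κ b) with h' | h' | h'
  · exact absurd h (card_filter_lt_lt_card_filter_lt ha h').ne
  · exact hκ ha hb h'
  · exact absurd h (card_filter_lt_lt_card_filter_lt hb h').ne'

theorem card_filter_lt_lt_card (ha : a ∈ S) : (S.filter (κ · < κ a)).card < S.card :=
  Finset.card_lt_card (Finset.filter_ssubset.2 ⟨a, ha, lt_irrefl _⟩)

theorem card_filter_lt_succ (hκ : Set.InjOn κ S) (ha : a ∈ S) (h : κ b = κ a + 1) :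
    (S.filter (κ · < κ b)).card = (S.filter (κ · < κ a)).card + 1 := by
  classical
  rw [← Finset.card_insert_of_notMem (s := S.filter (κ · < κ a)) (a := a) (by simp)]
  congr 1
  ext x
  simp only [Finset.mem_filter, Finset.mem_insert, h, Int.lt_add_one_iff]
  constructor
  · rintro ⟨hx, hle⟩
    rcases hle.lt_or_eq with h' | h'
    · exact Or.inr ⟨hx, h'⟩
    · exact Or.inl (hκ hx ha h')
  · rintro (rfl | ⟨hx, h'⟩)
    · exact ⟨ha, le_rfl⟩
    · exact ⟨hx, h'.le⟩

/-- A finite set invariant under an involution can be enumerated such that each element and its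
image are consecutive. -/
theorem exists_enumeration_of_involution [Finite V] (S : Finset V) (mate : V → V)
    (hmate : ∀ v, mate (mate v) = v) (hS : ∀ v, mate v ∈ S ↔ v ∈ S) : ∃ lev : V → ℤ,
    (∀ a b, a ∈ S → b ∈ S → lev a = lev b → a = b) ∧
    (∀ a, a ∈ S → mate a ≠ a → lev (mate a) = lev a + 1 ∨ lev a = lev (mate a) + 1) ∧
    ∀ a, a ∈ S → 0 ≤ lev a ∧ lev a < S.card := by
  have : Fintype V := Fintype.ofFinite V
  set e : V → ℕ := fun v => Fintype.equivFin V v with he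
  have hinj : ∀ u v, e u = e v → u = v := fun u v h =>
    (Fintype.equivFin V).injective (Fin.ext h)
  set κ : V → ℤ := fun v => 2 * min (e v) (e (mate v)) + if e (mate v) < e v then 1 else 0
    with hκ
  have hκinj : Function.Injective κ := by
    intro u v huv
    simp only [hκ] at huv
    by_contra hne
    have h1 := mt (hinj u v) hne
    have h2 : e (mate u) ≠ e (mate v) := fun h =>
      hne (by rw [← hmate u, hinj _ _ h, hmate])
    split_ifs at huv <;> omega
  have hsucc : ∀ v, e v < e (mate v) → κ (mate v) = κ v + 1 := by
    intro v hv
    simp only [hκ, hmate, if_pos hv, if_neg hv.not_gt]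
    omega
  refine ⟨fun v => (S.filter (κ · < κ v)).card, fun a b ha hb h => ?_, fun a ha hne => ?_,
    fun a ha => ?_⟩
  · exact card_filter_lt_injOn hκinj.injOn ha hb (Nat.cast_injective h)
  · dsimp only
    rcases lt_or_gt_of_ne (mt (hinj _ _) hne) with h | h
    · right
      have := hsucc (mate a) (by rwa [hmate])
      rw [hmate] at this
      exact_mod_cast card_filter_lt_succ hκinj.injOn ((hS a).2 ha) this
    · left
      exact_mod_cast card_filter_lt_succ hκinj.injOn ha (hsucc a h)
  · exact ⟨by positivity, Nat.cast_lt.2 (card_filter_lt_lt_card ha)⟩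

end Rank

section Coloring

variable {V : Type*}

/-- Greedy extension of a coloring from `S` to `S ∪ T`. -/
theorem exists_coloring_union [DecidableEq V] {K : ℕ} [NeZero K] (H : V → V → Prop) [DecidableRel H]
    (hsymm : ∀ u v, H u v → H v u) (hirr : ∀ u, ¬ H u u) (S T : Finset V)
    (hS : ∃ c : V → Fin K, ∀ u ∈ S, ∀ v ∈ S, H u v → c u ≠ c v)
    (hT : ∀ v ∈ T, ((S ∪ T).filter (H v)).card < K) :
    ∃ c : V → Fin K, ∀ u ∈ S ∪ T, ∀ v ∈ S ∪ T, H u v → c u ≠ c v := by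
  induction T using Finset.induction_on with
  | empty => simpa using hS
  | insert x T hx ih =>
    obtain ⟨c, hc⟩ := ih fun v hv => lt_of_le_of_lt
      (Finset.card_le_card (Finset.filter_subset_filter _
        (Finset.union_subset_union_right (Finset.subset_insert x T))))
      (hT v (Finset.mem_insert_of_mem hv))
    have hlt : (((S ∪ insert x T).filter (H x)).image c).card < (Finset.univ : Finset (Fin K)).card :=
      lt_of_le_of_lt Finset.card_image_le
        (by simpa using hT x (Finset.mem_insert_self x T))
    obtain ⟨i, -, hi⟩ := Finset.exists_mem_notMem_of_card_lt_card hlt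
    have hfree : ∀ v ∈ S ∪ insert x T, H x v → c v ≠ i := fun v hv hxv hvi =>
      hi (Finset.mem_image.2 ⟨v, Finset.mem_filter.2 ⟨hv, hxv⟩, hvi⟩)
    refine ⟨Function.update c x i, fun u hu v hv huv => ?_⟩
    by_cases hux : u = x
    · subst hux
      have hvu : v ≠ u := by rintro rfl; exact hirr _ huv
      rw [Function.update_self, Function.update_of_ne hvu]
      exact (hfree v hv huv).symm
    · by_cases hvx : v = x
      · subst hvx
        rw [Function.update_self, Function.update_of_ne hux]
        exact hfree u hu (hsymm _ _ huv)
      · rw [Function.update_of_ne hux, Function.update_of_ne hvx]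
        refine hc u ?_ v ?_ huv
        · simpa [hux] using hu
        · simpa [hvx] using hv

/-- The colors of a coloring can be permuted such that the sizes of the classes decrease. -/
theorem exists_sorted_coloring {K : ℕ} (S : Finset V) (c : V → Fin K) :
    ∃ c' : V → ℕ, (∀ v, c' v < K) ∧ (∀ u v, c' u = c' v → c u = c v) ∧
      ∀ i, (S.filter (c' · = i + 1)).card ≤ (S.filter (c' · = i)).card := by
  set f : Fin K → ℤ := fun i => -((S.filter (c · = i)).card : ℤ) with hf
  refine ⟨fun v => ((Tuple.sort f).symm (c v) : ℕ), fun v => Fin.is_lt _, fun u v h =>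
    (Tuple.sort f).symm.injective (Fin.ext h), fun i => ?_⟩
  by_cases hi : i + 1 < K
  · have hcard : ∀ j : Fin K, (S.filter fun v => ((Tuple.sort f).symm (c v) : ℕ) = j).card =
        (S.filter (c · = Tuple.sort f j)).card := by
      intro j
      congr 1
      refine Finset.filter_congr fun v _ => ?_
      rw [← Fin.ext_iff, Equiv.symm_apply_eq]
    have hmono := Tuple.monotone_sort f (show (⟨i, by omega⟩ : Fin K) ≤ ⟨i + 1, hi⟩ by simp)
    simp only [Function.comp, hf, neg_le_neg_iff, Nat.cast_le] at hmono
    rw [hcard ⟨i + 1, hi⟩, hcard ⟨i, by omega⟩]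
    exact hmono
  · rw [Finset.filter_false_of_mem]
    · simp
    · intro v _ h
      dsimp only at h
      have := ((Tuple.sort f).symm (c v)).is_lt
      omega

end Coloring

section Curve

theorem exists_antidifference (f : ℤ → ℤ) : ∃ g : ℤ → ℤ, g 0 = 0 ∧ ∀ s, g (s + 1) = g s + f s := by
  refine ⟨fun s => ∑ i ∈ Finset.range s.toNat, f i -
    ∑ i ∈ Finset.range (-s).toNat, f (-(i + 1 : ℕ)), by simp, fun s => ?_⟩
  rcases le_or_gt 0 s with hs | hs
  · obtain ⟨k, rfl⟩ := Int.eq_ofNat_of_zero_le hs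
    have h1 : ((k : ℤ) + 1).toNat = k + 1 := by omega
    have h2 : (-((k : ℤ) + 1)).toNat = 0 := by omega
    simp only [h1, h2, Finset.sum_range_succ, Int.toNat_natCast, Int.toNat_neg_natCast,
      Finset.range_zero, Finset.sum_empty, sub_zero]
  · obtain ⟨k, rfl⟩ : ∃ k : ℕ, s = -(k + 1 : ℕ) := ⟨(-s - 1).toNat, by omega⟩
    have h1 : (-((k + 1 : ℕ) : ℤ) + 1).toNat = 0 := by omega
    have h2 : (-(-((k + 1 : ℕ) : ℤ) + 1)).toNat = k := by omega
    have h3 : (-((k + 1 : ℕ) : ℤ)).toNat = 0 := by omega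
    have h4 : (- -((k + 1 : ℕ) : ℤ)).toNat = k + 1 := by omega
    simp only [h1, h2, h3, h4, Finset.sum_range_succ]
    ring

/-- Between the abscissas `t s` and `t (s + 1)`, the upper envelope of the lines
`y = s * x + d s` is the line of slope `s`. -/
theorem line_lt_of_breakpoints {t d : ℤ → ℤ} (ht : Monotone t)
    (hd : ∀ s, d (s + 1) = d s - t (s + 1)) {s s' x : ℤ} (h1 : t s < x) (h2 : x < t (s + 1))
    (hs : s' ≠ s) : s' * x + d s' < s * x + d s := by
  have hstep : ∀ r, (r + 1) * x + d (r + 1) = r * x + d r + (x - t (r + 1)) := by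
    intro r; rw [hd]; ring
  rcases lt_or_gt_of_ne hs with h | h
  · induction s', (Int.le_sub_one_of_lt h) using Int.leInductionDown with
    | base =>
      have := hstep (s - 1)
      rw [sub_add_cancel] at this
      omega
    | pred r hr ih =>
      have := hstep (r - 1)
      rw [sub_add_cancel] at this
      have := ih (by omega) (by omega)
      have := ht (show r ≤ s by omega)
      omega
  · induction s', (Int.add_one_le_of_lt h) using Int.leInduction with
    | base =>
      have := hstep s
      omega
    | succ r hr ih =>
      have := hstep r
      have := ih (by omega) (by omega)
      have := ht (show s + 1 ≤ r + 1 by omega)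
      omega

end Curve

section Blocks

variable {V : Type*}

/-- From each two-element orbit of an involution, one element can be selected. -/
theorem exists_selection_of_involution [Fintype V] (mate : V → V)
    (hmate : ∀ v, mate (mate v) = v) : ∃ D : Finset V,
    (∀ v, mate v ≠ v → (mate v ∈ D ↔ v ∉ D)) ∧ ∀ v, mate v = v → v ∉ D := by
  set e := Fintype.equivFin V with he
  refine ⟨Finset.univ.filter fun v => e (mate v) < e v, fun v hv => ?_, fun v hv => ?_⟩
  · have : e (mate v) ≠ e v := e.injective.ne hv
    simp only [Finset.mem_filter_univ, hmate]
    omega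
  · simp [hv]

variable [Fintype V] [DecidableEq V] {G : SimpleGraph V} [DecidableRel G.Adj] {A D : Finset V}
  {mate : V → V}

theorem card_neighbors_inter (hd : ∀ v, G.degree v = 3) (hmem : ∀ v, mate v ∈ A ↔ v ∈ A)
    (hadj : ∀ v, mate v ≠ v → G.Adj v (mate v))
    (heq : ∀ v w, G.Adj v w → (w ∈ A ↔ v ∈ A) → w = mate v) {v : V} (hv : v ∉ A) :
    ((G.neighborFinset v).filter (· ∈ A)).card = if mate v = v then 3 else 2 := by
  rw [← hd v, ← G.card_neighborFinset_eq_degree]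
  split_ifs with h
  · rw [Finset.filter_true_of_mem]
    intro w hw
    by_contra hwA
    have hvw : G.Adj v w := by simpa using hw
    exact hvw.ne' ((heq v w hvw (by tauto)).trans h)
  · have : (G.neighborFinset v).filter (· ∈ A) = (G.neighborFinset v).erase (mate v) := by
      ext w
      simp only [Finset.mem_filter, Finset.mem_erase, SimpleGraph.mem_neighborFinset]
      constructor
      · rintro ⟨hw, hwA⟩
        refine ⟨?_, hw⟩
        rintro rfl
        exact hv ((hmem v).1 hwA)
      · rintro ⟨hne, hw⟩
        refine ⟨hw, ?_⟩
        by_contra hwA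
        exact hne (heq v w hw (by tauto))
    rw [this, Finset.card_erase_of_mem (by simpa using hadj v h), G.card_neighborFinset_eq_degree,
      hd]

/-- The blocks containing `u` and `v` have a common neighbor in `A`. -/
def BlockConflict (G : SimpleGraph V) (A : Finset V) (mate : V → V) (u v : V) : Prop :=
  u ≠ v ∧ ∃ a ∈ A, (G.Adj a u ∨ G.Adj a (mate u)) ∧ (G.Adj a v ∨ G.Adj a (mate v))

theorem card_conflict_le (hd : ∀ v, G.degree v = 3) (hmate : ∀ v, mate (mate v) = v)
    (hmem : ∀ v, mate v ∈ A ↔ v ∈ A) (hadj : ∀ v, mate v ≠ v → G.Adj v (mate v))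
    (heq : ∀ v w, G.Adj v w → (w ∈ A ↔ v ∈ A) → w = mate v)
    (hD : ∀ v, mate v ≠ v → (mate v ∈ D ↔ v ∉ D)) {C : Finset V} {u : V} (huA : u ∉ A)
    (huD : u ∉ D) (hC : ∀ v ∈ C, v ∉ D ∧ BlockConflict G A mate u v) :
    C.card ≤ if mate u = u then 6 else 8 := by
  set rep : V → V := fun v => if v ∈ D then mate v else v with hrep
  have hrep_self : ∀ {v}, v ∉ D → rep v = v := fun hv => by simp [hrep, hv]
  have hrep_mate : ∀ {v}, v ∉ D → rep (mate v) = v := by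
    intro v hv
    by_cases h : mate v = v
    · rw [h, hrep_self hv]
    · simp [hrep, (hD v h).2 hv, hmate]
  have hsub : C ⊆ ({u, mate u} : Finset V).biUnion fun x =>
      ((G.neighborFinset x).filter (· ∈ A)).biUnion fun a =>
        ((G.neighborFinset a).erase x).image rep := by
    intro v hv
    obtain ⟨hvD, huv, a, ha, hau, hav⟩ := hC v hv
    obtain ⟨x, hx, hax, hxu⟩ : ∃ x, (x = u ∨ x = mate u) ∧ G.Adj a x ∧ rep x = u := by
      rcases hau with h | h
      exacts [⟨u, Or.inl rfl, h, hrep_self huD⟩, ⟨mate u, Or.inr rfl, h, hrep_mate huD⟩]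
    obtain ⟨y, hay, hyv⟩ : ∃ y, G.Adj a y ∧ rep y = v := by
      rcases hav with h | h
      exacts [⟨v, h, hrep_self hvD⟩, ⟨mate v, h, hrep_mate hvD⟩]
    simp only [Finset.mem_biUnion, Finset.mem_insert, Finset.mem_singleton, Finset.mem_filter,
      Finset.mem_image, Finset.mem_erase, SimpleGraph.mem_neighborFinset]
    refine ⟨x, hx, a, ⟨hax.symm, ha⟩, y, ⟨?_, hay⟩, hyv⟩
    rintro rfl
    exact huv (hxu.symm.trans hyv)
  have hinner : ∀ x ∈ ({u, mate u} : Finset V), (((G.neighborFinset x).filter (· ∈ A)).biUnion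
      fun a => ((G.neighborFinset a).erase x).image rep).card ≤
        (if mate u = u then 3 else 2) * 2 := by
    intro x hx
    have hcard : ((G.neighborFinset x).filter (· ∈ A)).card = if mate u = u then 3 else 2 := by
      rcases Finset.mem_insert.1 hx with rfl | hx
      · exact card_neighbors_inter hd hmem hadj heq huA
      · rw [Finset.mem_singleton.1 hx, card_neighbors_inter hd hmem hadj heq (by rwa [hmem]), hmate]
        simp only [eq_comm]
    rw [← hcard]
    refine Finset.card_biUnion_le_card_mul _ _ _ fun a ha => ?_
    refine Finset.card_image_le.trans ?_
    have hxa : x ∈ G.neighborFinset a := by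
      simp only [Finset.mem_filter, SimpleGraph.mem_neighborFinset] at ha
      simpa using ha.1.symm
    rw [Finset.card_erase_of_mem hxa, G.card_neighborFinset_eq_degree, hd]
  refine (Finset.card_le_card hsub).trans
    ((Finset.card_biUnion_le_card_mul _ _ _ hinner).trans ?_)
  split_ifs with h
  · simp [h]
  · have := Finset.card_le_two (a := u) (b := mate u)
    omega

/-- The vertices outside `A`, one from each block. -/
def blockReps (A D : Finset V) : Finset V := Finset.univ.filter fun v => v ∉ A ∧ v ∉ D

/-- The representatives of the two-element blocks. -/
def pairReps (A D : Finset V) (mate : V → V) : Finset V :=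
  (blockReps A D).filter fun v => mate v ≠ v

theorem six_mul_card_blockReps_le (hd : ∀ v, G.degree v = 3) (hmate : ∀ v, mate (mate v) = v)
    (hmem : ∀ v, mate v ∈ A ↔ v ∈ A) (hadj : ∀ v, mate v ≠ v → G.Adj v (mate v))
    (heq : ∀ v w, G.Adj v w → (w ∈ A ↔ v ∈ A) → w = mate v)
    (hD : ∀ v, mate v ≠ v → (mate v ∈ D ↔ v ∉ D)) (hD' : ∀ v, mate v = v → v ∉ D) :
    6 * (blockReps A D).card + 4 * (pairReps A D mate).card ≤ 3 * Fintype.card V := by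
  have hcross : ∑ b ∈ Aᶜ, ((G.neighborFinset b).filter (· ∈ A)).card ≤ A.card * 3 := by
    have := Finset.sum_card_bipartiteAbove_eq_sum_card_bipartiteBelow (s := Aᶜ) (t := A) G.Adj
    calc ∑ b ∈ Aᶜ, ((G.neighborFinset b).filter (· ∈ A)).card
        = ∑ b ∈ Aᶜ, (Finset.bipartiteAbove G.Adj A b).card := by
          refine Finset.sum_congr rfl fun b _ => congrArg _ ?_
          ext w
          simp [Finset.bipartiteAbove, and_comm]
      _ = ∑ a ∈ A, (Finset.bipartiteBelow G.Adj Aᶜ a).card := this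
      _ ≤ A.card * 3 := by
          refine Finset.sum_le_card_nsmul _ _ _ fun a _ => ?_
          rw [← hd a, ← G.card_neighborFinset_eq_degree]
          refine Finset.card_le_card fun w hw => ?_
          simp only [Finset.bipartiteBelow, Finset.mem_filter] at hw
          simpa using hw.2.symm
  rw [Finset.sum_congr rfl fun b hb => card_neighbors_inter hd hmem hadj heq
    (Finset.mem_compl.1 hb), Finset.sum_ite, Finset.sum_const, Finset.sum_const] at hcross
  have hsingle : Aᶜ.filter (fun v => mate v = v) = (blockReps A D).filter fun v => mate v = v := by
    ext v
    simp only [blockReps, Finset.mem_filter, Finset.mem_compl, Finset.mem_univ, true_and]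
    have := hD' v
    tauto
  have hsplit := Finset.card_filter_add_card_filter_not (s := blockReps A D)
    (fun v => mate v = v)
  have hsplit' := Finset.card_filter_add_card_filter_not (s := Aᶜ) (fun v => mate v = v)
  have hpair : (Aᶜ.filter fun v => ¬ mate v = v).card = 2 * (pairReps A D mate).card := by
    have h1 := Finset.card_filter_add_card_filter_not (s := Aᶜ.filter fun v => ¬ mate v = v)
      (fun v => v ∉ D)
    have h2 : (Aᶜ.filter fun v => ¬ mate v = v).filter (fun v => v ∉ D) = pairReps A D mate := by
      ext v
      simp only [pairReps, blockReps, Finset.mem_filter, Finset.mem_compl, Finset.mem_univ,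
        true_and]
      tauto
    have h3 : (Aᶜ.filter fun v => ¬ mate v = v).filter (fun v => ¬ v ∉ D) =
        (pairReps A D mate).image mate := by
      ext v
      simp only [pairReps, blockReps, Finset.mem_filter, Finset.mem_compl, Finset.mem_univ,
        true_and, Finset.mem_image]
      constructor
      · rintro ⟨⟨h, h'⟩, h''⟩
        have := (hD v h').not
        exact ⟨mate v, by simp only [hmate, hmem]; tauto, hmate v⟩
      · rintro ⟨w, ⟨⟨h, h'⟩, h''⟩, rfl⟩
        have := hD w h''
        simp only [hmate, hmem]
        tauto
    rw [h2, h3, Finset.card_image_of_injective _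
      (Function.LeftInverse.injective hmate)] at h1
    omega
  have hpair' : (pairReps A D mate).card =
    ((blockReps A D).filter fun v => ¬ mate v = v).card := rfl
  rw [hpair, hsingle] at hcross hsplit'
  have := Finset.card_compl_add_card A
  simp only [smul_eq_mul] at hcross
  omega

theorem exists_block_coloring (hd : ∀ v, G.degree v = 3) (hmate : ∀ v, mate (mate v) = v)
    (hmem : ∀ v, mate v ∈ A ↔ v ∈ A) (hadj : ∀ v, mate v ≠ v → G.Adj v (mate v))
    (heq : ∀ v w, G.Adj v w → (w ∈ A ↔ v ∈ A) → w = mate v)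
    (hD : ∀ v, mate v ≠ v → (mate v ∈ D ↔ v ∉ D)) : ∃ c : V → ℕ,
    (∀ v, c v < if (pairReps A D mate).card < 8 then 7 else 9) ∧
    (∀ u ∈ blockReps A D, ∀ v ∈ blockReps A D, BlockConflict G A mate u v → c u ≠ c v) ∧
    ∀ i, ((blockReps A D).filter (c · = i + 1)).card ≤
      ((blockReps A D).filter (c · = i)).card := by
  classical
  set K := if (pairReps A D mate).card < 8 then 7 else 9 with hK
  have : NeZero K := ⟨by rw [hK]; split_ifs <;> norm_num⟩
  set H := BlockConflict G A mate with hH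
  have hsymm : ∀ u v, H u v → H v u := fun u v ⟨h, a, ha, h1, h2⟩ => ⟨h.symm, a, ha, h2, h1⟩
  have hirr : ∀ u, ¬ H u u := fun u h => h.1 rfl
  have hbound : ∀ u ∈ blockReps A D, ∀ C ⊆ blockReps A D,
      (C.filter (H u)).card ≤ if mate u = u then 6 else 8 := by
    intro u hu C hC
    simp only [blockReps, Finset.mem_filter_univ] at hu
    refine card_conflict_le hd hmate hmem hadj heq hD hu.1 hu.2 fun v hv => ?_
    have hv' := hC (Finset.mem_of_mem_filter v hv)
    simp only [blockReps, Finset.mem_filter_univ] at hv'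
    exact ⟨hv'.2, (Finset.mem_filter.1 hv).2⟩
  have hpairs : ∃ c : V → Fin K, ∀ u ∈ pairReps A D mate, ∀ v ∈ pairReps A D mate,
      H u v → c u ≠ c v := by
    have := exists_coloring_union (K := K) H hsymm hirr ∅ (pairReps A D mate)
      ⟨fun _ => 0, by simp⟩ ?_
    · simpa using this
    · intro v hv
      rw [Finset.empty_union]
      by_cases ht : (pairReps A D mate).card < 8
      · rw [hK, if_pos ht]
        have : ((pairReps A D mate).filter (H v)).card < (pairReps A D mate).card :=
          Finset.card_lt_card (Finset.filter_ssubset.2 ⟨v, hv, hirr v⟩)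
        omega
      · rw [hK, if_neg ht]
        have := hbound v (Finset.mem_of_mem_filter v hv) (pairReps A D mate)
          (Finset.filter_subset _ _)
        split_ifs at this <;> omega
  have hunion : pairReps A D mate ∪ (blockReps A D).filter (fun v => mate v = v) =
      blockReps A D := by
    rw [Finset.union_comm]
    exact Finset.filter_union_filter_not_eq _ _
  obtain ⟨c, hc⟩ := exists_coloring_union H hsymm hirr (pairReps A D mate)
    ((blockReps A D).filter fun v => mate v = v) hpairs fun v hv => by
      have := hbound v (Finset.mem_of_mem_filter v hv) _ hunion.subset
      rw [if_pos (Finset.mem_filter.1 hv).2] at this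
      have : 7 ≤ K := by rw [hK]; split_ifs <;> norm_num
      omega
  rw [hunion] at hc
  obtain ⟨c', h1, h2, h3⟩ := exists_sorted_coloring (blockReps A D) c
  exact ⟨c', h1, fun u hu v hv huv h => hc u hu v hv huv (h2 u v h), h3⟩

end Blocks

section Bounds

/-- The slope of the edges of the curve that carry the blocks of color `i`: the slopes
`0, 1, -1, 2, -2, …` are used in turn. -/
def colorSlope (i : ℕ) : ℤ := if i % 2 = 0 then -((i / 2 : ℕ) : ℤ) else ((i / 2 : ℕ) : ℤ) + 1

theorem colorSlope_injective : Function.Injective colorSlope := by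
  intro i j h
  unfold colorSlope at h
  split_ifs at h <;> omega

/-- Numerical bounds for the positions of the blocks: `R s` is the number of blocks of slope less
than `s`, and `n i` that of the blocks of color `i`, among which there are `N` in all, `t` of
which have two elements. -/
theorem block_bounds {R d : ℤ → ℤ} {n : ℕ → ℤ} {N t m s r x : ℤ}
    (hR : ∀ i, i < 9 → R (colorSlope i + 1) = R (colorSlope i) + n i) (hR0 : R (-4) = 0)
    (hRN : R 5 = N) (hd0 : d 0 = 0)
    (hd : ∀ s, d (s + 1) = d s - (2 * R (s + 1) + (s + 1) - 1))
    (hn : ∀ i, n (i + 1) ≤ n i) (hn8 : 0 ≤ n 8) (ht : n 7 = 0 ∨ 8 ≤ t) (ht0 : 0 ≤ t)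
    (hm : 3 * N + 2 * t ≤ m)
    (hs : -4 ≤ s) (hs' : s ≤ 4) (hr : R s ≤ r) (hr' : r + 1 ≤ R (s + 1))
    (hx : 2 * r + s ≤ x) (hx' : x ≤ 2 * r + s + 1) :
    ((if 0 < n 8 then -4 else if 0 < n 6 then -3 else if 0 < n 4 then -2 else
      if 0 < n 2 then -1 else 0) ≤ x ∧ x < (if 0 < n 8 then -4 else if 0 < n 6 then -3 else
        if 0 < n 4 then -2 else if 0 < n 2 then -1 else 0) + m) ∧
    -1 < s * x + d s ∧ s * x + d s + 1 < -1 + m := by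
  have R0 := hR 0 (by norm_num)
  have R1 := hR 1 (by norm_num)
  have R2 := hR 2 (by norm_num)
  have R3 := hR 3 (by norm_num)
  have R4 := hR 4 (by norm_num)
  have R5 := hR 5 (by norm_num)
  have R6 := hR 6 (by norm_num)
  have R7 := hR 7 (by norm_num)
  have R8 := hR 8 (by norm_num)
  have d3 := hd (-4)
  have d2 := hd (-3)
  have d1 := hd (-2)
  have d0 := hd (-1)
  have e0 := hd 0
  have e1 := hd 1
  have e2 := hd 2
  have e3 := hd 3
  have n0 := hn 0
  have n1 := hn 1
  have n2 := hn 2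
  have n3 := hn 3
  have n4 := hn 4
  have n5 := hn 5
  have n6 := hn 6
  have n7 := hn 7
  clear hR hd hn
  norm_num [colorSlope] at R0 R1 R2 R3 R4 R5 R6 R7 R8 d3 d2 d1 d0 e0 e1 e2 e3 n0 n1 n2 n3 n4 n5 n6 n7
  have hx0 : ∃ x0 : ℤ, x0 = (if 0 < n 8 then -4 else if 0 < n 6 then -3 else
      if 0 < n 4 then -2 else if 0 < n 2 then -1 else 0) ∧ x0 ≤ 0 ∧ (n 8 ≤ 0 ∨ x0 = -4) ∧
      (n 6 ≤ 0 ∨ x0 ≤ -3) ∧ (n 4 ≤ 0 ∨ x0 ≤ -2) ∧ (n 2 ≤ 0 ∨ x0 ≤ -1) ∧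
      (0 < n 8 ∨ -3 ≤ x0) ∧ (0 < n 6 ∨ -2 ≤ x0) ∧ (0 < n 4 ∨ -1 ≤ x0) ∧ (0 < n 2 ∨ 0 ≤ x0) := by
    refine ⟨_, rfl, ?_⟩
    split_ifs <;> omega
  interval_cases s <;> norm_num at hr hr' hx hx' ⊢
  all_goals
    obtain ⟨x0, hx0, hbound⟩ := hx0
    rw [← hx0]
    refine ⟨⟨?_, ?_⟩, ?_, ?_⟩ <;> omega

end Bounds

/-- The elements of `S` can be ranked by `σ`, with ties broken. -/
theorem exists_rank {V : Type*} [Finite V] (S : Finset V) (σ : V → ℤ) : ∃ r : V → ℤ,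
    (∀ u ∈ S, ∀ v ∈ S, r u = r v → u = v) ∧
    ∀ v ∈ S, ((S.filter (σ · < σ v)).card : ℤ) ≤ r v ∧
      r v + 1 ≤ (S.filter (σ · < σ v + 1)).card := by
  have : Fintype V := Fintype.ofFinite V
  set e := Fintype.equivFin V with he
  set κ : V → ℤ := fun v => σ v * Fintype.card V + (e v : ℕ) with hκ
  have hlt : ∀ {u v}, σ u < σ v → κ u < κ v := by
    intro u v h
    have h1 : (σ u + 1) * (Fintype.card V : ℤ) ≤ σ v * Fintype.card V :=
      mul_le_mul_of_nonneg_right h (by positivity)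
    have h2 : ((e u : ℕ) : ℤ) < Fintype.card V := by exact_mod_cast (e u).is_lt
    have h3 : (0 : ℤ) ≤ (e v : ℕ) := by positivity
    simp only [hκ]
    linarith
  have hinj : Function.Injective κ := by
    intro u v h
    rcases lt_trichotomy (σ u) (σ v) with h' | h' | h'
    · exact absurd h (hlt h').ne
    · simp only [hκ, h', add_right_inj, Nat.cast_inj] at h
      exact e.injective (Fin.ext h)
    · exact absurd h (hlt h').ne'
  refine ⟨fun v => (S.filter (κ · < κ v)).card, fun u hu v hv h =>
    card_filter_lt_injOn hinj.injOn hu hv (Nat.cast_injective h), fun v hv => ⟨?_, ?_⟩⟩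
  · exact Nat.cast_le.2 (Finset.card_le_card
      (Finset.monotone_filter_right S fun u _ hu => hlt hu))
  · have : (S.filter (κ · < κ v)).card < (S.filter (σ · < σ v + 1)).card := by
      refine Finset.card_lt_card (Finset.ssubset_iff_of_subset ?_ |>.2 ⟨v, by simp [hv], by simp⟩)
      refine Finset.monotone_filter_right S fun u _ hu => ?_
      by_contra h
      exact lt_asymm hu (hlt (by simp only [not_lt] at h; omega))
    dsimp only
    omega

theorem card_filter_lt_add_one {V : Type*} (S : Finset V) (σ : V → ℤ) (s : ℤ) :
    (S.filter (σ · < s + 1)).card = (S.filter (σ · < s)).card + (S.filter (σ · = s)).card := by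
  classical
  rw [← Finset.card_union_of_disjoint, ← Finset.filter_or]
  · congr 1
    exact Finset.filter_congr fun v _ => by omega
  · exact Finset.disjoint_filter.2 fun v _ h h' => by omega

theorem exists_triangleLayout {V : Type*} [Fintype V] [DecidableEq V] (G : SimpleGraph V)
    [DecidableRel G.Adj] (hcubic : ∀ v, G.degree v = 3) :
    ∃ (L : TriangleLayout G) (x0 y0 : ℤ),
      (∀ b, ¬ L.A b → x0 ≤ L.start b ∧
        L.start b + 1 < x0 + (3 * Fintype.card V / 2 : ℕ)) ∧
      (∀ b x, ¬ L.A b → L.start b ≤ x → x ≤ L.start b + 1 →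
        y0 < L.height b x ∧ L.height b x + 1 < y0 + (3 * Fintype.card V / 2 : ℕ)) ∧
      (∀ a, L.A a → 0 ≤ L.lev a ∧ L.lev a < (Fintype.card V / 2 : ℕ)) := by
  obtain ⟨A, mate, outer, hA, mate_mate, mate_mem, adj_mate, eq_mate, adj_outer, outer_mem⟩ :=
    exists_cut_mate_of_cubic G hcubic
  obtain ⟨lev, lev_inj, lev_mate, lev_bound⟩ :=
    exists_enumeration_of_involution A mate mate_mate mate_mem
  obtain ⟨D, hD, hD'⟩ := exists_selection_of_involution mate mate_mate
  obtain ⟨c, hcK, hconf, hsorted⟩ :=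
    exists_block_coloring hcubic mate_mate mate_mem adj_mate eq_mate hD
  have hsize := six_mul_card_blockReps_le hcubic mate_mate mate_mem adj_mate eq_mate hD hD'
  set S := blockReps A D with hS
  set t := (pairReps A D mate).card with ht
  set σ : V → ℤ := fun v => colorSlope (c v) with hσ
  obtain ⟨r, hr_inj, hr⟩ := exists_rank S σ
  set R : ℤ → ℤ := fun s => (S.filter (σ · < s)).card with hR
  obtain ⟨d, hd0, hd⟩ := exists_antidifference fun s => -(2 * R (s + 1) + (s + 1) - 1)
  have hc9 : ∀ v, c v < 9 := fun v => (hcK v).trans_le (by split_ifs <;> norm_num)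
  set rep : V → V := fun v => if v ∈ D then mate v else v with hrep
  have hrep_mem : ∀ {b}, b ∉ A → rep b ∈ S := by
    intro b hb
    rw [hS, blockReps, Finset.mem_filter_univ]
    by_cases h : b ∈ D
    · have hne : mate b ≠ b := fun h' => hD' b h' h
      have := hD b hne
      simp only [hrep, if_pos h, mate_mem]
      tauto
    · simp only [hrep, if_neg h]
      exact ⟨hb, h⟩
  have hrep_mate : ∀ b, rep (mate b) = rep b := by
    intro b
    by_cases hb : mate b = b
    · rw [hb]
    · have := hD b hb
      by_cases h : b ∈ D
      · simp [hrep, h, this]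
      · simp [hrep, h, this, mate_mate]
  have hrep_eq : ∀ b, rep b = b ∨ rep b = mate b := by
    intro b
    by_cases h : b ∈ D <;> simp [hrep, h]
  have hrep_ne : ∀ {b w}, w ≠ b → w ≠ mate b → rep b ≠ rep w := by
    intro b w h1 h2 h
    rcases hrep_eq b with hb | hb <;> rcases hrep_eq w with hw | hw <;> rw [hb, hw] at h
    · exact h1 h.symm
    · exact h2 (by rw [h, mate_mate])
    · exact h2 h.symm
    · exact h1 (by rw [← mate_mate w, ← h, mate_mate])
  have hRmono : Monotone R := fun s s' h => Nat.cast_le.2 (Finset.card_le_card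
    (Finset.monotone_filter_right S fun u _ hu => lt_of_lt_of_le hu h))
  have hr' : ∀ {b}, b ∉ A → R (σ (rep b)) ≤ r (rep b) ∧ r (rep b) + 1 ≤ R (σ (rep b) + 1) :=
    fun hb => hr _ (hrep_mem hb)
  let L : TriangleLayout G :=
    { A := fun v => v ∈ A
      mate := mate
      outer := outer
      right := fun v => v ∈ D
      lev := lev
      start := fun b => 2 * r (rep b) + σ (rep b)
      slope := fun b => σ (rep b)
      icpt := d
      mate_mate := mate_mate
      mate_mem := mate_mem
      adj_mate := adj_mate
      eq_mate := eq_mate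
      adj_outer := adj_outer
      outer_mem := outer_mem
      lev_inj := lev_inj
      lev_mate := lev_mate
      right_mate := hD
      start_mate := fun b => by rw [hrep_mate]
      slope_mate := fun b => by rw [hrep_mate]
      start_sep := fun b w hb hw h1 h2 => by
        have hne : r (rep b) ≠ r (rep w) := fun h =>
          hrep_ne h1 h2 (hr_inj _ (hrep_mem hb) _ (hrep_mem hw) h)
        have hb' := hr' hb
        have hw' := hr' hw
        rcases lt_trichotomy (σ (rep b)) (σ (rep w)) with h | h | h
        · have := hRmono (show σ (rep b) + 1 ≤ σ (rep w) by omega)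
          omega
        · rw [h]
          omega
        · have := hRmono (show σ (rep w) + 1 ≤ σ (rep b) by omega)
          omega
      slope_ne := fun a b w ha hab haw hb hw h1 h2 h => by
        have hadj : ∀ {x}, G.Adj a x → G.Adj a (rep x) ∨ G.Adj a (mate (rep x)) := by
          intro x hx
          rcases hrep_eq x with h | h <;> rw [h]
          · exact Or.inl hx
          · rw [mate_mate]; exact Or.inr hx
        exact hconf _ (hrep_mem hb) _ (hrep_mem hw) ⟨hrep_ne h1 h2, a, ha, hadj hab, hadj haw⟩
          (colorSlope_injective h)
      line_lt := fun b w x _ hw hne h1 h2 => by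
        have := hr' hw
        refine line_lt_of_breakpoints (t := fun s => 2 * R s + s - 1) (fun s s' h => ?_)
          (fun s => by rw [hd]; ring) ?_ ?_ hne
        · have := hRmono h
          dsimp only
          omega
        · omega
        · omega }
  have hclass : ∀ i, (S.filter (σ · = colorSlope i)).card = (S.filter (c · = i)).card := by
    intro i
    congr 1
    exact Finset.filter_congr fun v _ => colorSlope_injective.eq_iff
  have hσ_bound : ∀ v, -4 ≤ σ v ∧ σ v ≤ 4 := by
    intro v
    have := hc9 v
    simp only [hσ, colorSlope]
    split_ifs <;> omega
  have hbounds := fun b (hb : b ∉ A) x => block_bounds (R := R) (d := d)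
    (n := fun i => ((S.filter (c · = i)).card : ℤ)) (N := S.card) (t := t)
    (m := (3 * Fintype.card V / 2 : ℕ)) (s := σ (rep b)) (r := r (rep b)) (x := x)
    (fun i _ => by
      simp only [hR, ← hclass]
      exact_mod_cast card_filter_lt_add_one S σ (colorSlope i))
    (by
      simp only [hR]
      rw [Finset.filter_false_of_mem fun v _ => not_lt.2 (hσ_bound v).1]
      simp)
    (by
      simp only [hR]
      rw [Finset.filter_true_of_mem fun v _ => (hσ_bound v).2.trans_lt (by norm_num)])
    hd0 (fun s => by rw [hd]; ring) (fun i => Nat.cast_le.2 (hsorted i)) (by positivity)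
    (by
      by_cases h : t < 8
      · left
        rw [Finset.filter_false_of_mem fun v _ => ?_]
        · simp
        · have := hcK v
          rw [if_pos h] at this
          exact this.ne
      · right
        omega)
    (by positivity) (by omega) (hσ_bound _).1 (hσ_bound _).2 (hr' hb).1 (hr' hb).2
  refine ⟨L, _, -1, fun b hb => ⟨(hbounds b hb _ le_rfl (by omega)).1.1,
    (hbounds b hb _ (by omega) le_rfl).1.2⟩, fun b x hb h1 h2 => (hbounds b hb x h1 h2).2,
    fun a ha => ?_⟩
  have := lev_bound a ha
  change 0 ≤ lev a ∧ lev a < _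
  omega

/-- **Theorem 4 of the paper.** Every cubic graph with `n` vertices can be
realized as a contact graph of triangles with vertices on an integer grid of size
`3n/2 × 3n/2 × n/2`. -/
theorem cubic_triangle_representation
    {V : Type*} [Fintype V] [DecidableEq V] (G : SimpleGraph V) [DecidableRel G.Adj]
    (n : ℕ) (hn : n = Fintype.card V)
    (hcubic : ∀ v, G.degree v = 3) :
    ∃ (p : G.edgeSet → EuclideanSpace ℝ (Fin 3)) (x0 y0 z0 : ℤ),
      Function.Injective p ∧
      -- all contact points lie on an integer grid of size 3n/2 × 3n/2 × n/2
      (∀ e : G.edgeSet, ∃ a b c : ℤ,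
        p e 0 = (a : ℝ) ∧ p e 1 = (b : ℝ) ∧ p e 2 = (c : ℝ) ∧
        x0 ≤ a ∧ a < x0 + (3 * n / 2 : ℕ) ∧
        y0 ≤ b ∧ b < y0 + (3 * n / 2 : ℕ) ∧
        z0 ≤ c ∧ c < z0 + (n / 2 : ℕ)) ∧
      -- for each vertex, the three incident contact points are affinely independent
      (∀ v : V, AffineIndependent ℝ
        (fun e : {e : G.edgeSet // v ∈ (e : Sym2 V)} => p e.1)) ∧
      -- triangles of adjacent vertices meet exactly in the contact point of their edge
      (∀ u v (huv : G.Adj u v),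
        convexHull ℝ {x | ∃ e : G.edgeSet, u ∈ (e : Sym2 V) ∧ x = p e} ∩
          convexHull ℝ {x | ∃ e : G.edgeSet, v ∈ (e : Sym2 V) ∧ x = p e} =
          {p ⟨s(u, v), G.mem_edgeSet.mpr huv⟩}) ∧
      -- triangles of distinct non-adjacent vertices are disjoint
      (∀ u v, u ≠ v → ¬ G.Adj u v →
        convexHull ℝ {x | ∃ e : G.edgeSet, u ∈ (e : Sym2 V) ∧ x = p e} ∩
          convexHull ℝ {x | ∃ e : G.edgeSet, v ∈ (e : Sym2 V) ∧ x = p e} = ∅) := by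
  subst hn
  obtain ⟨L, x0, y0, hx, hy, hz⟩ := exists_triangleLayout G hcubic
  exact L.exists_representation hcubic _ _ x0 y0 hx hy hz
end

section
/- Let (V, B) be a Steiner quadruple system, i.e., V is a finite set and B is a family of 4-element subsets of V such that every 3-element subset of V is contained in exactly one member of B. Suppose there is a non-crossing drawing of (V, B) by quadrilaterals in ℝ³: an injective map p : V → ℝ³ together with, for each block b ∈ B, a filled quadrilateral Q_b with corner set p(b), such that Q_b ∩ Q_{b'} = p(b ∩ b') for all distinct blocks b, b' ∈ B. Then every 2-dimensional affine subspace of ℝ³ contains at most four of the points p(v), v ∈ V. -/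
/-- `Q` is a filled quadrilateral with corner set `s`: `s` consists of four distinct
coplanar points which, for some labeling `a, b, c, d`, split `Q` into the two triangles
`conv {a, b, c}` and `conv {a, c, d}` meeting exactly in the segment `[a, c]`. -/
def IsFilledQuadrilateral (Q s : Set (EuclideanSpace ℝ (Fin 3))) : Prop :=
  ∃ a b c d : EuclideanSpace ℝ (Fin 3),
    s = {a, b, c, d} ∧
    a ≠ b ∧ a ≠ c ∧ a ≠ d ∧ b ≠ c ∧ b ≠ d ∧ c ≠ d ∧
    Coplanar ℝ ({a, b, c, d} : Set (EuclideanSpace ℝ (Fin 3))) ∧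
    AffineIndependent ℝ ![a, b, c] ∧ AffineIndependent ℝ ![a, c, d] ∧
    convexHull ℝ ({a, b, c} : Set (EuclideanSpace ℝ (Fin 3))) ∩
      convexHull ℝ ({a, c, d} : Set (EuclideanSpace ℝ (Fin 3))) = segment ℝ a c ∧
    Q = convexHull ℝ ({a, b, c} : Set (EuclideanSpace ℝ (Fin 3))) ∪
      convexHull ℝ ({a, c, d} : Set (EuclideanSpace ℝ (Fin 3)))

/-- All segments between corners of a filled quadrilateral, except possibly the diagonal from
`b` to `d`, are contained in it. -/
theorem IsFilledQuadrilateral.exists_segment_subset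
    {Q s : Set (EuclideanSpace ℝ (Fin 3))} (h : IsFilledQuadrilateral Q s) :
    ∃ a b d, a ∈ s ∧ a ≠ b ∧ a ≠ d ∧ b ≠ d ∧ ∀ x ∈ s, ∀ y ∈ s,
      ¬(x = b ∧ y = d) → ¬(x = d ∧ y = b) → segment ℝ x y ⊆ Q := by
  obtain ⟨a, b, c, d, rfl, hab, -, had, -, hbd, -, -, -, -, -, rfl⟩ := h
  refine ⟨a, b, d, by simp, hab, had, hbd, fun x hx y hy h₁ h₂ => ?_⟩
  have key (T : Set (EuclideanSpace ℝ (Fin 3))) (hx : x ∈ T) (hy : y ∈ T) :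
      segment ℝ x y ⊆ convexHull ℝ T :=
    (convex_convexHull ℝ T).segment_subset (subset_convexHull ℝ T hx) (subset_convexHull ℝ T hy)
  have hxy : (x ∈ ({a, b, c} : Set _) ∧ y ∈ ({a, b, c} : Set _)) ∨
      (x ∈ ({a, c, d} : Set _) ∧ y ∈ ({a, c, d} : Set _)) := by
    simp only [Set.mem_insert_iff, Set.mem_singleton_iff] at hx hy ⊢
    tauto
  rcases hxy with ⟨hx, hy⟩ | ⟨hx, hy⟩
  · exact (key _ hx hy).trans Set.subset_union_left
  · exact (key _ hx hy).trans Set.subset_union_right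

/-- At each corner, at most one of the segments to the other corners is not contained in the
filled quadrilateral. -/
theorem IsFilledQuadrilateral.segment_subset_or
    {Q s : Set (EuclideanSpace ℝ (Fin 3))} (h : IsFilledQuadrilateral Q s)
    {x y z : EuclideanSpace ℝ (Fin 3)} (hx : x ∈ s) (hy : y ∈ s) (hz : z ∈ s) (hyz : y ≠ z) :
    segment ℝ x y ⊆ Q ∨ segment ℝ x z ⊆ Q := by
  obtain ⟨a, b, d, -, -, -, hbd, H⟩ := h.exists_segment_subset
  by_cases hbad : (x = b ∧ y = d) ∨ (x = d ∧ y = b)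
  · exact Or.inr (H x hx z hz (by grind) (by grind))
  · exact Or.inl (H x hx y hy (by grind) (by grind))

/-- Some corner of a filled quadrilateral sees all corners within the quadrilateral. -/
theorem IsFilledQuadrilateral.exists_forall_segment_subset
    {Q s : Set (EuclideanSpace ℝ (Fin 3))} (h : IsFilledQuadrilateral Q s) :
    ∃ x ∈ s, ∀ y ∈ s, segment ℝ x y ⊆ Q := by
  obtain ⟨a, b, d, ha, hab, had, -, H⟩ := h.exists_segment_subset
  exact ⟨a, ha, fun y hy => H a ha y hy (fun h => hab h.1) fun h => had h.1⟩

/-- A segment with distinct endpoints is infinite. -/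
theorem infinite_segment_of_ne {E : Type*} [AddCommGroup E] [Module ℝ E] {x y : E}
    (hxy : x ≠ y) : (segment ℝ x y).Infinite := by
  rw [segment_eq_image_lineMap]
  exact (Set.Icc_infinite zero_lt_one).image (AffineMap.lineMap_injective ℝ hxy).injOn

/-- A non-crossing drawing by quadrilaterals exists only for Steiner quadruple systems on at
most four points. -/
theorem card_le_four_of_noncrossing_drawing
    {V : Type*} [Fintype V] [DecidableEq V] (B : Finset (Finset V))
    (hcard : ∀ b ∈ B, b.card = 4)
    (hsteiner : ∀ t : Finset V, t.card = 3 → ∃! b, b ∈ B ∧ t ⊆ b)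
    (p : V → EuclideanSpace ℝ (Fin 3)) (hp : Function.Injective p)
    (Q : Finset V → Set (EuclideanSpace ℝ (Fin 3)))
    (hQ : ∀ b ∈ B, IsFilledQuadrilateral (Q b) (p '' (b : Set V)))
    (hmeet : ∀ b ∈ B, ∀ b' ∈ B, b ≠ b' → Q b ∩ Q b' = p '' ((b ∩ b' : Finset V) : Set V)) :
    Fintype.card V ≤ 4 := by
  by_contra! hV
  have unique_segment {b b' : Finset V} (hb : b ∈ B) (hb' : b' ∈ B) {x y : V} (hxy : x ≠ y)
      (h : segment ℝ (p x) (p y) ⊆ Q b) (h' : segment ℝ (p x) (p y) ⊆ Q b') : b = b' := by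
    by_contra hne
    refine infinite_segment_of_ne (hp.ne hxy) (Set.Finite.subset ?_ (Set.subset_inter h h'))
    rw [hmeet b hb b' hb' hne]
    exact (Finset.finite_toSet _).image p
  obtain ⟨t, -, ht⟩ := Finset.exists_subset_card_eq (s := (Finset.univ : Finset V)) (n := 3)
    (by rw [Finset.card_univ]; omega)
  obtain ⟨b, ⟨hb, -⟩, -⟩ := hsteiner t ht
  obtain ⟨e, -, he⟩ := Finset.exists_mem_notMem_of_card_lt_card (s := b) (t := Finset.univ)
    (by rw [hcard b hb, Finset.card_univ]; exact hV)
  obtain ⟨_, ⟨x, hx, rfl⟩, hseg⟩ := (hQ b hb).exists_forall_segment_subset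
  rw [Finset.mem_coe] at hx
  obtain ⟨y, hy, z, hz, hyz⟩ := Finset.one_lt_card.mp
    (show 1 < (b.erase x).card by rw [Finset.card_erase_of_mem hx, hcard b hb]; norm_num)
  rw [Finset.mem_erase] at hy hz
  have hex : e ≠ x := by grind
  have exists_block {w : V} (hw : w ∈ b) (hwx : w ≠ x) :
      ∃ b' ∈ B, x ∈ b' ∧ w ∈ b' ∧ e ∈ b' ∧ segment ℝ (p x) (p e) ⊆ Q b' := by
    have hew : e ≠ w := by grind
    obtain ⟨b', ⟨hb', hsub⟩, -⟩ := hsteiner {x, w, e}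
      (Finset.card_eq_three.mpr ⟨x, w, e, hwx.symm, hex.symm, hew.symm, rfl⟩)
    have hx' : x ∈ b' := hsub (by simp)
    have hw' : w ∈ b' := hsub (by simp)
    have he' : e ∈ b' := hsub (by simp)
    refine ⟨b', hb', hx', hw', he', ?_⟩
    refine ((hQ b' hb').segment_subset_or (Set.mem_image_of_mem p hx')
      (Set.mem_image_of_mem p hw') (Set.mem_image_of_mem p he') (hp.ne hew.symm)).resolve_left
      fun h => he ?_
    rwa [unique_segment hb hb' hwx.symm (hseg _ (Set.mem_image_of_mem p hw)) h]
  obtain ⟨b₁, hb₁, hx₁, hy₁, he₁, h₁⟩ := exists_block hy.2 hy.1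
  obtain ⟨b₂, hb₂, -, hz₂, -, h₂⟩ := exists_block hz.2 hz.1
  obtain rfl := unique_segment hb₁ hb₂ hex.symm h₁ h₂
  have hb_eq : b₁ = b := (hsteiner {x, y, z}
    (Finset.card_eq_three.mpr ⟨x, y, z, hy.1.symm, hz.1.symm, hyz, rfl⟩)).unique
    ⟨hb₁, by grind⟩ ⟨hb, by grind⟩
  exact he (hb_eq ▸ he₁)

/-- **Observation 1 of the paper.** In a non-crossing drawing of a Steiner
quadruple system by quadrilaterals in ℝ³, every plane (2-dimensional affine subspace)
contains at most four of the vertex points. -/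
theorem steiner_quadruple_system_at_most_four_in_plane
    {V : Type*} [Fintype V] [DecidableEq V] (B : Finset (Finset V))
    (hcard : ∀ b ∈ B, b.card = 4)
    (hsteiner : ∀ t : Finset V, t.card = 3 → ∃! b, b ∈ B ∧ t ⊆ b)
    (p : V → EuclideanSpace ℝ (Fin 3)) (hp : Function.Injective p)
    (Q : Finset V → Set (EuclideanSpace ℝ (Fin 3)))
    (hQ : ∀ b ∈ B, IsFilledQuadrilateral (Q b) (p '' (b : Set V)))
    (hmeet : ∀ b ∈ B, ∀ b' ∈ B, b ≠ b' → Q b ∩ Q b' = p '' ((b ∩ b' : Finset V) : Set V)) :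
    ∀ W : AffineSubspace ℝ (EuclideanSpace ℝ (Fin 3)),
      Module.finrank ℝ W.direction = 2 →
      Set.ncard {v : V | p v ∈ W} ≤ 4 := by
  intro W _
  refine (Set.ncard_le_ncard (Set.subset_univ _)).trans ?_
  rw [Set.ncard_univ, Nat.card_eq_fintype_card]
  exact card_le_four_of_noncrossing_drawing B hcard hsteiner p hp Q hQ hmeet
end

section
/- The Fano plane admits a non-crossing drawing by triangles in ℝ³: there exists an injective map p : {1, …, 7} → ℝ³ such that for each of the seven blocks b ∈ {{1,2,3}, {1,4,7}, {1,5,6}, {2,4,6}, {2,5,7}, {3,4,5}, {3,6,7}} the three points p(b) are affinely independent, and for any two distinct blocks b, b' one has conv(p(b)) ∩ conv(p(b')) = p(b ∩ b') (a single point, since any two blocks of the Fano plane share exactly one element). -/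
/-- The seven blocks of the Fano plane `S(2,3,7)` on `{1, …, 7}`. -/
def fanoBlocks : Finset (Finset ℕ) :=
  {{1, 2, 3}, {1, 4, 7}, {1, 5, 6}, {2, 4, 6}, {2, 5, 7}, {3, 4, 5}, {3, 6, 7}}

/-- A point together with an open half-space whose boundary contains it is convex. -/
theorem convex_insert_halfSpace_gt {E : Type*} [AddCommGroup E] [Module ℝ E]
    (f : E →ₗ[ℝ] ℝ) (v : E) : Convex ℝ (insert v {x | f v < f x}) := by
  rw [convex_iff_forall_pos]
  intro x hx y hy a b ha hb hab
  have hv : f v = a * f v + b * f v := by rw [← add_mul, hab, one_mul]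
  rcases hx with rfl | hx <;> rcases hy with rfl | hy
  · left
    rw [← add_smul, hab, one_smul]
  all_goals
    right
    simp only [Set.mem_ofPred_eq, map_add, map_smul, smul_eq_mul] at *
    nlinarith

/-- If a linear functional strictly separates `s` from `t` except at a common point `v`, then
the convex hulls of `s` and `t` meet only in `v`. -/
theorem convexHull_inter_convexHull_eq_singleton {E : Type*} [AddCommGroup E] [Module ℝ E]
    (f : E →ₗ[ℝ] ℝ) {v : E} {s t : Set E} (hvs : v ∈ s) (hvt : v ∈ t)
    (hs : ∀ x ∈ s, x = v ∨ f v < f x) (ht : ∀ x ∈ t, x = v ∨ f x < f v) :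
    convexHull ℝ s ∩ convexHull ℝ t = {v} := by
  refine Set.Subset.antisymm ?_ (Set.singleton_subset_iff.2
    ⟨subset_convexHull ℝ s hvs, subset_convexHull ℝ t hvt⟩)
  rintro x ⟨hxs, hxt⟩
  have h₁ : x = v ∨ f v < f x := convexHull_min hs (convex_insert_halfSpace_gt f v) hxs
  have h₂ : x = v ∨ (-f) v < (-f) x :=
    convexHull_min (fun y hy => (ht y hy).imp id fun h => by simpa using h)
      (convex_insert_halfSpace_gt (-f) v) hxt
  rcases h₁ with h₁ | h₁
  · exact h₁
  rcases h₂ with h₂ | h₂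
  · exact h₂
  · simp only [LinearMap.neg_apply, neg_lt_neg_iff] at h₂
    exact absurd h₁ h₂.not_gt

/-- Three points of `ℝ³` are affinely independent if the cross product of two edge vectors has a
nonzero coordinate. -/
theorem affineIndependent_of_minor_ne_zero {a b c : EuclideanSpace ℝ (Fin 3)} (i j : Fin 3)
    (h : (b i - a i) * (c j - a j) - (b j - a j) * (c i - a i) ≠ 0) :
    AffineIndependent ℝ ![a, b, c] := by
  rw [affineIndependent_iff_linearIndependent_vsub ℝ _ (0 : Fin 3),
    ← linearIndependent_equiv (finSuccAboveEquiv (0 : Fin 3))]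
  have hfun : (fun k : {x : Fin 3 // x ≠ 0} => (![a, b, c] k -ᵥ ![a, b, c] 0 :
      EuclideanSpace ℝ (Fin 3))) ∘ finSuccAboveEquiv (0 : Fin 3) = ![b - a, c - a] := by
    ext k
    fin_cases k <;> simp [finSuccAboveEquiv_apply]
  rw [hfun, LinearIndependent.pair_iff]
  intro s t hst
  have hi : s * (b i - a i) + t * (c i - a i) = 0 := by simpa using congr($hst i)
  have hj : s * (b j - a j) + t * (c j - a j) = 0 := by simpa using congr($hst j)
  constructor
  · refine (mul_eq_zero.1 ?_).resolve_right h
    linear_combination (c j - a j) * hi - (c i - a i) * hj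
  · refine (mul_eq_zero.1 ?_).resolve_right h
    linear_combination (b i - a i) * hj - (b j - a j) * hi

/-- Integer coordinates for the points of a non-crossing drawing of the Fano plane. -/
def fanoCoord : ℕ → Fin 3 → ℤ
  | 1 => ![2, 0, -2]
  | 2 => ![2, 0, 2]
  | 3 => ![2, -2, 2]
  | 4 => ![0, 0, 1]
  | 5 => ![-2, 2, 1]
  | 6 => ![-1, -2, -2]
  | _ => ![-2, 0, 2]

/-- The dot product of integer vectors with three coordinates. -/
def intDot (n x : Fin 3 → ℤ) : ℤ := n 0 * x 0 + n 1 * x 1 + n 2 * x 2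

/-- Normal vectors, up to sign, of planes separating the triangles of the drawing. -/
def fanoNormals : List (Fin 3 → ℤ) :=
  [![0, 1, -3], ![0, 1, -1], ![1, -3, -3], ![1, 3, -1], ![2, -2, 1], ![2, 1, -1], ![0, 1, 3],
    ![1, -3, 1], ![1, 2, -1], ![1, 2, 3], ![2, -2, 3], ![2, 1, -3], ![2, 2, -1], ![2, 3, 3],
    ![3, -2, -1]]

theorem fanoCoord_injOn :
    ∀ i ∈ Finset.Icc 1 7, ∀ j ∈ Finset.Icc 1 7, fanoCoord i = fanoCoord j → i = j := by
  decide +kernel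

theorem fanoCoord_minor_ne_zero :
    ∀ i ∈ Finset.Icc 1 7, ∀ j ∈ Finset.Icc 1 7, ∀ k ∈ Finset.Icc 1 7,
      ({i, j, k} : Finset ℕ) ∈ fanoBlocks → ∃ r s : Fin 3,
        (fanoCoord j r - fanoCoord i r) * (fanoCoord k s - fanoCoord i s) -
          (fanoCoord j s - fanoCoord i s) * (fanoCoord k r - fanoCoord i r) ≠ 0 := by
  decide +kernel

theorem fanoBlocks_separated :
    ∀ b ∈ fanoBlocks, ∀ b' ∈ fanoBlocks, b ≠ b' → ∃ v ∈ b, b ∩ b' = {v} ∧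
      ∃ n ∈ fanoNormals ++ fanoNormals.map (fun n i => -n i),
        (∀ x ∈ b, x = v ∨ intDot n (fanoCoord v) < intDot n (fanoCoord x)) ∧
        (∀ x ∈ b', x = v ∨ intDot n (fanoCoord x) < intDot n (fanoCoord v)) := by
  decide +kernel

theorem fanoBlocks_subset_Icc : ∀ b ∈ fanoBlocks, b ⊆ Finset.Icc 1 7 := by
  decide

/-- The points of a non-crossing drawing of the Fano plane. -/
noncomputable def fanoPoint (i : ℕ) : EuclideanSpace ℝ (Fin 3) :=
  WithLp.toLp 2 fun r => (fanoCoord i r : ℝ)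

/-- The linear functional on `ℝ³` given by the dot product with an integer vector. -/
noncomputable def dotFunctional (n : Fin 3 → ℤ) : EuclideanSpace ℝ (Fin 3) →ₗ[ℝ] ℝ where
  toFun x := n 0 * x 0 + n 1 * x 1 + n 2 * x 2
  map_add' x y := by simp only [PiLp.add_apply]; ring
  map_smul' c x := by simp only [PiLp.smul_apply, smul_eq_mul, RingHom.id_apply]; ring

theorem dotFunctional_fanoPoint (n : Fin 3 → ℤ) (i : ℕ) :
    dotFunctional n (fanoPoint i) = (intDot n (fanoCoord i) : ℝ) := by
  simp [dotFunctional, fanoPoint, intDot]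



/-- **part of Proposition 2 of the paper.** The Fano plane admits a
non-crossing drawing by triangles in ℝ³: there is an injective map
`p : {1, …, 7} → ℝ³` such that the points of each block are affinely independent and the
triangles of any two distinct blocks intersect exactly in the image of their common
element. -/
theorem fano_plane_triangle_drawing :
    ∃ p : ℕ → EuclideanSpace ℝ (Fin 3),
      Set.InjOn p (Set.Icc 1 7) ∧
      (∀ i j k : ℕ, ({i, j, k} : Finset ℕ) ∈ fanoBlocks →
        AffineIndependent ℝ ![p i, p j, p k]) ∧
      (∀ b ∈ fanoBlocks, ∀ b' ∈ fanoBlocks, b ≠ b' →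
        convexHull ℝ (p '' (b : Set ℕ)) ∩ convexHull ℝ (p '' (b' : Set ℕ)) =
          p '' ((b ∩ b' : Finset ℕ) : Set ℕ)) := by
  refine ⟨fanoPoint, ?_, ?_, ?_⟩
  · intro i hi j hj hij
    refine fanoCoord_injOn i (Finset.mem_Icc.2 hi) j (Finset.mem_Icc.2 hj) (funext fun r => ?_)
    have hr : (fanoCoord i r : ℝ) = fanoCoord j r := congr($hij r)
    exact_mod_cast hr
  · intro i j k h
    have hsub := fanoBlocks_subset_Icc _ h
    obtain ⟨r, s, hrs⟩ := fanoCoord_minor_ne_zero i (hsub (by simp)) j (hsub (by simp))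
      k (hsub (by simp)) h
    refine affineIndependent_of_minor_ne_zero r s ?_
    simp only [fanoPoint]
    exact_mod_cast hrs
  · intro b hb b' hb' hne
    obtain ⟨v, hv, hinter, n, -, hpos, hneg⟩ := fanoBlocks_separated b hb b' hb' hne
    have hv' : v ∈ b' :=
      Finset.mem_of_mem_inter_right (hinter ▸ Finset.mem_singleton_self v : v ∈ b ∩ b')
    rw [hinter, Finset.coe_singleton, Set.image_singleton]
    refine convexHull_inter_convexHull_eq_singleton (dotFunctional n)
      (Set.mem_image_of_mem _ hv) (Set.mem_image_of_mem _ hv') ?_ ?_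
    · rintro _ ⟨x, hx, rfl⟩
      simp only [dotFunctional_fanoPoint, Int.cast_lt]
      exact (hpos x hx).imp (congrArg _) id
    · rintro _ ⟨x, hx, rfl⟩
      simp only [dotFunctional_fanoPoint, Int.cast_lt]
      exact (hneg x hx).imp (congrArg _) id
end

section
/- The Steiner triple system S(2,3,9) admits a non-crossing drawing by triangles in ℝ³: there exists an injective map p : {1, …, 9} → ℝ³ such that for each of the twelve blocks b ∈ {{1,2,3}, {4,5,6}, {7,8,9}, {1,4,7}, {2,5,8}, {3,6,9}, {1,5,9}, {2,6,7}, {3,4,8}, {1,6,8}, {2,4,9}, {3,5,7}} the three points p(b) are affinely independent, and for any two distinct blocks b, b' one has conv(p(b)) ∩ conv(p(b')) = p(b ∩ b') (so two triangles share exactly the image of the common element if the blocks intersect, and are disjoint if the blocks are disjoint). -/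
/-- The twelve blocks of the Steiner triple system `S(2,3,9)` on `{1, …, 9}`. -/
def steiner9Blocks : Finset (Finset ℕ) :=
  {{1, 2, 3}, {4, 5, 6}, {7, 8, 9}, {1, 4, 7}, {2, 5, 8}, {3, 6, 9},
   {1, 5, 9}, {2, 6, 7}, {3, 4, 8}, {1, 6, 8}, {2, 4, 9}, {3, 5, 7}}

section Separation

variable {E : Type*} [AddCommGroup E] [Module ℝ E]

/-- If a linear functional is strictly larger on `S` than on `T`, common points aside, then the
convex hulls of `S` and `T` meet only in `S ∩ T`. -/
theorem convexHull_inter_convexHull_of_forall_lt {S T : Set E} (f : E →ₗ[ℝ] ℝ)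
    (h : ∀ x ∈ S, ∀ y ∈ T, x ≠ y → f y < f x) :
    convexHull ℝ S ∩ convexHull ℝ T = S ∩ T := by
  refine Set.Subset.antisymm ?_
    (Set.inter_subset_inter (subset_convexHull ℝ S) (subset_convexHull ℝ T))
  rintro x ⟨hxS, hxT⟩
  obtain ⟨ι, _, w, z, hw₀, hw₁, hz, hwx⟩ := mem_convexHull_iff_exists_fintype.1 hxS
  obtain ⟨κ, _, v, u, hv₀, hv₁, hu, hvx⟩ := mem_convexHull_iff_exists_fintype.1 hxT
  have hfw : ∑ i, w i * f (z i) = f x := by simp [← hwx]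
  have hfv : ∑ j, v j * f (u j) = f x := by simp [← hvx]
  have nonneg (i : ι) (j : κ) : 0 ≤ w i * v j * (f (z i) - f (u j)) := by
    refine mul_nonneg (mul_nonneg (hw₀ i) (hv₀ j)) ?_
    by_cases hij : z i = u j
    · simp [hij]
    · exact sub_nonneg.2 (h _ (hz i) _ (hu j) hij).le
  have sum_eq : ∑ i, ∑ j, w i * v j * (f (z i) - f (u j)) = 0 := by
    have expand (i : ι) : ∑ j, w i * v j * (f (z i) - f (u j)) = w i * f (z i) - w i * f x := by
      calc ∑ j, w i * v j * (f (z i) - f (u j))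
          = (w i * f (z i)) * ∑ j, v j - w i * ∑ j, v j * f (u j) := by
            rw [Finset.mul_sum, Finset.mul_sum, ← Finset.sum_sub_distrib]
            exact Finset.sum_congr rfl fun j _ => by ring
        _ = w i * f (z i) - w i * f x := by rw [hv₁, hfv, mul_one]
    simp_rw [expand, Finset.sum_sub_distrib, ← Finset.sum_mul, hfw, hw₁, one_mul, sub_self]
  have eq_of_ne_zero (i : ι) (j : κ) (hi : w i ≠ 0) (hj : v j ≠ 0) : z i = u j := by
    by_contra hij
    have hrow := (Finset.sum_eq_zero_iff_of_nonneg fun i _ =>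
      Finset.sum_nonneg fun j _ => nonneg i j).1 sum_eq i (Finset.mem_univ i)
    have hterm := (Finset.sum_eq_zero_iff_of_nonneg fun j _ => nonneg i j).1 hrow j
      (Finset.mem_univ j)
    exact mul_ne_zero (mul_ne_zero hi hj) (sub_pos.2 (h _ (hz i) _ (hu j) hij)).ne' hterm
  obtain ⟨i, -, hi⟩ := Finset.exists_ne_zero_of_sum_ne_zero (hw₁ ▸ one_ne_zero : ∑ i, w i ≠ 0)
  obtain ⟨j, -, hj⟩ := Finset.exists_ne_zero_of_sum_ne_zero (hv₁ ▸ one_ne_zero : ∑ j, v j ≠ 0)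
  have hx : x = z i := by
    calc x = ∑ k, v k • z i := by
          rw [← hvx]
          refine Finset.sum_congr rfl fun k _ => ?_
          by_cases hk : v k = 0
          · simp [hk]
          · rw [eq_of_ne_zero i k hi hk]
      _ = z i := by rw [← Finset.sum_smul, hv₁, one_smul]
  exact ⟨hx ▸ hz i, hx ▸ eq_of_ne_zero i j hi hj ▸ hu j⟩

/-- Indexed form of `convexHull_inter_convexHull_of_forall_lt`. -/
theorem convexHull_image_inter_of_forall_lt {ι : Type*} {p : ι → E} {s t : Set ι} (f : E →ₗ[ℝ] ℝ)
    (h : ∀ i ∈ s, ∀ j ∈ t, i ≠ j → f (p j) < f (p i)) :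
    convexHull ℝ (p '' s) ∩ convexHull ℝ (p '' t) = p '' (s ∩ t) := by
  rw [convexHull_inter_convexHull_of_forall_lt f]
  · refine Set.Subset.antisymm ?_ (Set.image_inter_subset p s t)
    rintro _ ⟨⟨i, hi, rfl⟩, j, hj, hij⟩
    obtain rfl : i = j := by
      by_contra hne
      exact (h i hi j hj hne).ne (by rw [hij])
    exact ⟨i, ⟨hi, hj⟩, rfl⟩
  · rintro _ ⟨i, hi, rfl⟩ _ ⟨j, hj, rfl⟩ hij
    exact h i hi j hj fun e => hij (e ▸ rfl)

end Separation

/-- The point of `ℝ³` with the given integer coordinates. -/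
noncomputable def intPoint (a : Fin 3 → ℤ) : EuclideanSpace ℝ (Fin 3) :=
  WithLp.toLp 2 fun i => (a i : ℝ)

theorem intPoint_injective : Function.Injective intPoint := by
  intro a b h
  ext i
  simpa [intPoint] using congrArg (fun x : EuclideanSpace ℝ (Fin 3) => x i) h

theorem affineIndependent_intPoint {a b c : Fin 3 → ℤ} (h : crossProduct (b - a) (c - a) ≠ 0) :
    AffineIndependent ℝ ![intPoint a, intPoint b, intPoint c] := by
  have hcross : crossProduct (fun l => ((b - a) l : ℝ)) (fun l => ((c - a) l : ℝ)) ≠ 0 := by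
    contrapose! h
    ext l
    have hl := congrFun h l
    have hcast : crossProduct (fun l => ((b - a) l : ℝ)) (fun l => ((c - a) l : ℝ)) l =
        (crossProduct (b - a) (c - a) l : ℤ) := by
      fin_cases l <;> simp [cross_apply] <;> ring
    rw [hl, Pi.zero_apply] at hcast
    exact_mod_cast hcast.symm
  have hind := crossProduct_ne_zero_iff_linearIndependent.1 hcross
  refine AffineIndependent.of_comp
    (WithLp.linearEquiv 2 ℝ (Fin 3 → ℝ)).toLinearMap.toAffineMap ?_
  rw [affineIndependent_iff_linearIndependent_vsub ℝ _ (0 : Fin 3),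
    ← linearIndependent_equiv (finSuccAboveEquiv (0 : Fin 3))]
  convert hind using 1
  · ext m l
    fin_cases m <;> simp [intPoint, finSuccAboveEquiv_apply]
  · rfl
  · rfl

theorem exists_linearMap_intPoint (n : Fin 3 → ℤ) :
    ∃ f : EuclideanSpace ℝ (Fin 3) →ₗ[ℝ] ℝ, ∀ a, f (intPoint a) = (dotProduct n a : ℤ) :=
  ⟨(∑ i, (n i : ℝ) • EuclideanSpace.proj (𝕜 := ℝ) i : EuclideanSpace ℝ (Fin 3) →L[ℝ] ℝ),
    fun a => by simp [intPoint, dotProduct]⟩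

/-- Integer coordinates of the vertices of a non-crossing drawing of `S(2,3,9)`. -/
def steiner9Coords : ℕ → Fin 3 → ℤ
  | 1 => ![1, 0, -1]
  | 2 => ![-3, 0, 0]
  | 3 => ![-2, 5, -2]
  | 4 => ![-1, 0, 0]
  | 5 => ![-5, -5, -4]
  | 6 => ![-2, -2, -2]
  | 7 => ![-1, -3, -5]
  | 8 => ![2, -5, 4]
  | 9 => ![-1, -2, -3]
  | _ => 0

/-- Normal vectors of planes separating the triangles of the drawing pairwise. -/
def steiner9Normals : List (Fin 3 → ℤ) :=
  [![2, -3, 3], ![7, 7, -4], ![1, -7, 3], ![1, 2, 3], ![6, -4, -5],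
   ![1, 1, 4], ![8, -2, 7], ![13, 8, -5], ![14, -23, 12], ![1, 1, -2],
   ![4, -10, 7], ![7, -4, -4], ![3, -2, -4], ![9, -1, 6], ![1, -11, 5],
   ![1, -5, 5], ![1, 2, 5], ![5, -15, 9], ![9, 1, 3], ![43, 5, -3]]

theorem steiner9Coords_injOn : Set.InjOn steiner9Coords (Set.Icc 1 9) := by
  have h : ∀ i ∈ Finset.Icc 1 9, ∀ j ∈ Finset.Icc 1 9,
      steiner9Coords i = steiner9Coords j → i = j := by
    decide +kernel
  exact fun i hi j hj => h i (Finset.mem_Icc.2 hi) j (Finset.mem_Icc.2 hj)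

theorem steiner9Blocks_card : ∀ b ∈ steiner9Blocks, b.card = 3 := by
  decide +kernel

theorem steiner9Coords_cross_ne_zero : ∀ b ∈ steiner9Blocks,
    ∀ i ∈ b, ∀ j ∈ b, ∀ k ∈ b, i ≠ j → i ≠ k → j ≠ k →
      crossProduct (steiner9Coords j - steiner9Coords i)
        (steiner9Coords k - steiner9Coords i) ≠ 0 := by
  decide +kernel

theorem exists_mem_steiner9Normals : ∀ b ∈ steiner9Blocks, ∀ b' ∈ steiner9Blocks,
    b ≠ b' → ∃ n ∈ steiner9Normals,
      (∀ i ∈ b, ∀ j ∈ b', i ≠ j →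
        dotProduct n (steiner9Coords j) < dotProduct n (steiner9Coords i)) ∨
      (∀ i ∈ b', ∀ j ∈ b, i ≠ j →
        dotProduct n (steiner9Coords j) < dotProduct n (steiner9Coords i)) := by
  decide +kernel

/-- **part of Proposition 2 of the paper.** The Steiner triple system
`S(2,3,9)` admits a non-crossing drawing by triangles in ℝ³: there is an injective map
`p : {1, …, 9} → ℝ³` such that the points of each block are affinely independent and the
triangles of any two distinct blocks intersect exactly in the image of the intersection
of the blocks. -/
theorem steiner_system_239_triangle_drawing :
    ∃ p : ℕ → EuclideanSpace ℝ (Fin 3),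
      Set.InjOn p (Set.Icc 1 9) ∧
      (∀ i j k : ℕ, ({i, j, k} : Finset ℕ) ∈ steiner9Blocks →
        AffineIndependent ℝ ![p i, p j, p k]) ∧
      (∀ b ∈ steiner9Blocks, ∀ b' ∈ steiner9Blocks, b ≠ b' →
        convexHull ℝ (p '' (b : Set ℕ)) ∩ convexHull ℝ (p '' (b' : Set ℕ)) =
          p '' ((b ∩ b' : Finset ℕ) : Set ℕ)) := by
  refine ⟨fun i => intPoint (steiner9Coords i), fun i hi j hj h =>
    steiner9Coords_injOn hi hj (intPoint_injective h), ?_, ?_⟩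
  · intro i j k hb
    have hcard := steiner9Blocks_card _ hb
    have hne : i ≠ j ∧ i ≠ k ∧ j ≠ k := by
      refine ⟨?_, ?_, ?_⟩ <;> rintro rfl <;> grind [Finset.card_le_two]
    exact affineIndependent_intPoint (steiner9Coords_cross_ne_zero _ hb i (by simp) j (by simp)
      k (by simp) hne.1 hne.2.1 hne.2.2)
  · intro b hb b' hb' hne
    obtain ⟨n, -, h⟩ := exists_mem_steiner9Normals b hb b' hb' hne
    obtain ⟨f, hf⟩ := exists_linearMap_intPoint n
    rw [Finset.coe_inter]
    rcases h with h | h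
    · exact convexHull_image_inter_of_forall_lt f fun i hi j hj hij => by
        simpa only [hf, Int.cast_lt] using h i hi j hj hij
    · rw [Set.inter_comm (convexHull ℝ _), Set.inter_comm (b : Set ℕ)]
      exact convexHull_image_inter_of_forall_lt f fun i hi j hj hij => by
        simpa only [hf, Int.cast_lt] using h i hi j hj hij
end

section
/- Let (V, B) be a Steiner quadruple system with |V| = n ≥ 8, i.e., B is a family of 4-element subsets of V such that every 3-element subset of V is contained in exactly one member of B. Then (V, B) admits no non-crossing drawing by convex quadrilaterals in ℝ³: there do not exist an injective map p : V → ℝ³ such that, for every block b ∈ B, the four points p(b) are coplanar and each is an extreme point of Q_b := conv(p(b)), and Q_b ∩ Q_{b'} = p(b ∩ b') for all distinct blocks b, b' ∈ B. -/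
/-- Two members of a convex-hull drawing whose hulls meet only in common vertices cannot share
two vertices without sharing a third one: their hulls both contain the midpoint. -/
theorem exists_third_mem_of_convexHull_inter_eq {V E : Type*} [DecidableEq V]
    [AddCommGroup E] [Module ℝ E] {p : V → E} (hp : Function.Injective p) {b b' : Finset V}
    (h : convexHull ℝ (p '' (b : Set V)) ∩ convexHull ℝ (p '' (b' : Set V)) =
      p '' ((b ∩ b' : Finset V) : Set V))
    {u v : V} (huv : u ≠ v) (hu : u ∈ b ∩ b') (hv : v ∈ b ∩ b') :
    ∃ x ∈ b ∩ b', x ≠ u ∧ x ≠ v := by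
  have key : ∀ c : Finset V, u ∈ c → v ∈ c →
      midpoint ℝ (p u) (p v) ∈ convexHull ℝ (p '' (c : Set V)) := fun c huc hvc =>
    (convex_convexHull ℝ _).midpoint_mem
      (subset_convexHull ℝ _ (Set.mem_image_of_mem p huc))
      (subset_convexHull ℝ _ (Set.mem_image_of_mem p hvc))
  rw [Finset.mem_inter] at hu hv
  obtain ⟨x, hx, hxm⟩ := h.subset ⟨key b hu.1 hv.1, key b' hu.2 hv.2⟩
  refine ⟨x, hx, ?_, ?_⟩
  · rintro rfl
    exact huv (hp ((midpoint_eq_left_iff ℝ).1 hxm.symm))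
  · rintro rfl
    exact huv (hp ((midpoint_eq_right_iff ℝ).1 hxm.symm))


/-- **first part of Theorem 6 of the paper.** No Steiner quadruple system
(on `n ≥ 8` vertices; every Steiner quadruple system has at least 8 vertices) admits a
non-crossing drawing by convex quadrilaterals in ℝ³: there is no injective
`p : V → ℝ³` such that for every block `b` the four points `p '' b` are coplanar and each
is an extreme point of `Q b = conv (p '' b)`, with `Q b ∩ Q b' = p '' (b ∩ b')` for all
distinct blocks `b, b'`. -/
theorem sqs_no_convex_quadrilateral_drawing
    {V : Type*} [Fintype V] [DecidableEq V] (n : ℕ) (hn : n = Fintype.card V)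
    (hn8 : 8 ≤ n) (B : Finset (Finset V))
    (hcard : ∀ b ∈ B, b.card = 4)
    (hsteiner : ∀ t : Finset V, t.card = 3 → ∃! b, b ∈ B ∧ t ⊆ b) :
    ¬ ∃ p : V → EuclideanSpace ℝ (Fin 3),
      Function.Injective p ∧
      (∀ b ∈ B, Coplanar ℝ (p '' (b : Set V)) ∧
        ∀ v ∈ b, p v ∉ convexHull ℝ
          ((convexHull ℝ (p '' (b : Set V))) \ {p v})) ∧
      (∀ b ∈ B, ∀ b' ∈ B, b ≠ b' →
        convexHull ℝ (p '' (b : Set V)) ∩ convexHull ℝ (p '' (b' : Set V)) =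
          p '' ((b ∩ b' : Finset V) : Set V)) := by
  rintro ⟨p, hp, -, hinter⟩
  obtain ⟨t, -, ht⟩ := Finset.exists_subset_card_eq
    (show 3 ≤ (Finset.univ : Finset V).card by rw [Finset.card_univ]; omega)
  obtain ⟨u, v, w, huv, huw, hvw, rfl⟩ := Finset.card_eq_three.1 ht
  obtain ⟨b, ⟨hb, htb⟩, -⟩ := hsteiner _ ht
  obtain ⟨z, hz⟩ : ∃ z, z ∉ b := by
    by_contra! hall
    have hcard_b := hcard b hb
    rw [Finset.eq_univ_iff_forall.2 hall, Finset.card_univ] at hcard_b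
    omega
  have hub : u ∈ b := htb (by simp)
  have hvb : v ∈ b := htb (by simp)
  obtain ⟨b', ⟨hb', htb'⟩, -⟩ := hsteiner {u, v, z}
    (Finset.card_eq_three.2 ⟨u, v, z, huv, fun h => hz (h ▸ hub), fun h => hz (h ▸ hvb), rfl⟩)
  have hne : b ≠ b' := fun h => hz (h ▸ htb' (by simp))
  have hu : u ∈ b ∩ b' := Finset.mem_inter.2 ⟨hub, htb' (by simp)⟩
  have hv : v ∈ b ∩ b' := Finset.mem_inter.2 ⟨hvb, htb' (by simp)⟩
  obtain ⟨x, hx, hxu, hxv⟩ :=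
    exists_third_mem_of_convexHull_inter_eq hp (hinter b hb b' hb' hne) huv hu hv
  have hsub : ({u, v, x} : Finset V) ⊆ b ∩ b' := by
    simp [Finset.insert_subset_iff, hu, hv, hx, -Finset.mem_inter]
  exact hne ((hsteiner {u, v, x}
    (Finset.card_eq_three.2 ⟨u, v, x, huv, hxu.symm, hxv.symm, rfl⟩)).unique
    ⟨hb, hsub.trans Finset.inter_subset_left⟩ ⟨hb', hsub.trans Finset.inter_subset_right⟩)
end
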